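/- arXiv:1704.07655 — 2 statements merged into one kernel-verified Lean document; each statement's English description precedes it below -/
import Mathlib

section
/- Let F be a field and suppose conditions (SS1) and (SS2) hold. For each l-multipartition λ of n, the F-vector space with basis {v^t : t standard λ-tableau}, with action e(i)v^t = δ_{i, i^t} v^t, x_r v^t = 0, and ψ_r v^t = v^{s_r t} (where v^{s_r t} := 0 if s_r t is not standard), satisfies all defining relations of the cyclotomic quiver Hecke algebra R^Λ_n of type C_ℓ^{(1)} and is an irreducible R^Λ_n-module. -/
/-- The type `C_ℓ^(1)` folding residue map valued in `I = Fin (ℓ+1)`: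
reduce mod `2ℓ`, then fold `k ↦ min (k, 2ℓ − k)` (for `ℓ ≥ 1` this value is `≤ ℓ`). -/
def barF (ℓ : ℕ) (m : ℤ) : Fin (ℓ + 1) :=
  ⟨min ((m % (2 * ℓ)).toNat) (2 * ℓ - (m % (2 * ℓ)).toNat) % (ℓ + 1),
    Nat.mod_lt _ (by omega)⟩

/-- Generators of the quiver Hecke algebra of type `C_ℓ^(1)` on `n` strands:
idempotents `e i` for `i ∈ I^n`, polynomial generators `x r`, and `ψ r` for `1 ≤ r ≤ n−1`. -/
inductive QGen (ℓ n : ℕ) : Type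
  | e : (Fin n → Fin (ℓ + 1)) → QGen ℓ n
  | x : Fin n → QGen ℓ n
  | p : Fin (n - 1) → QGen ℓ n

variable (F : Type) [Field F]

/-- The free algebra on the generators. -/
abbrev QFree (F : Type) [Field F] (ℓ n : ℕ) := FreeAlgebra F (QGen ℓ n)

namespace QH

variable {ℓ n : ℕ}

/-- `e(i)` as an element of the free algebra. -/
def E (F : Type) [Field F] {ℓ n : ℕ} (i : Fin n → Fin (ℓ + 1)) : QFree F ℓ n :=
  FreeAlgebra.ι F (QGen.e i)

/-- `x_r` as an element of the free algebra. -/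
def X (F : Type) [Field F] {ℓ n : ℕ} (r : Fin n) : QFree F ℓ n :=
  FreeAlgebra.ι F (QGen.x r)

/-- `ψ_r` as an element of the free algebra. -/
def P (F : Type) [Field F] {ℓ n : ℕ} (r : Fin (n - 1)) : QFree F ℓ n :=
  FreeAlgebra.ι F (QGen.p r)

/-- The strand `r` (0-indexed) of the crossing `ψ_r`. -/
def fa {n : ℕ} (r : Fin (n - 1)) : Fin n := ⟨r.val, by omega⟩

/-- The strand `r+1` (0-indexed) of the crossing `ψ_r`. -/
def fb {n : ℕ} (r : Fin (n - 1)) : Fin n := ⟨r.val + 1, by omega⟩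

/-- The action of the simple transposition `s_r` on sequences `i ∈ I^n`. -/
def sw {ℓ n : ℕ} (r : Fin (n - 1)) (i : Fin n → Fin (ℓ + 1)) : Fin n → Fin (ℓ + 1) :=
  i ∘ (Equiv.swap (fa r) (fb r))

/-- `⟨Λ_κ, α^∨_i⟩`: the number of components `j` of the multicharge with `bar κ_j = i`. -/
def wtMultF (ℓ : ℕ) {l : ℕ} (κ : Fin l → ℤ) (i : Fin (ℓ + 1)) : ℕ :=
  (Finset.univ.filter (fun j : Fin l => barF ℓ (κ j) = i)).card

/-- The defining relations of the cyclotomic quiver Hecke algebra `R^Λ_n` of type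
`C_ℓ^(1)` with `Λ = Λ_κ`, as listed in the paper. -/
inductive Rel (F : Type) [Field F] (ℓ n l : ℕ) (κ : Fin l → ℤ) :
    QFree F ℓ n → QFree F ℓ n → Prop
  | idem (i j : Fin n → Fin (ℓ + 1)) :
      Rel F ℓ n l κ (E F i * E F j) (if i = j then E F i else 0)
  | sum : Rel F ℓ n l κ (∑ i : Fin n → Fin (ℓ + 1), E F i) 1
  | xe (r : Fin n) (i : Fin n → Fin (ℓ + 1)) :
      Rel F ℓ n l κ (X F r * E F i) (E F i * X F r)
  | xx (r s : Fin n) : Rel F ℓ n l κ (X F r * X F s) (X F s * X F r)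
  | pe (r : Fin (n - 1)) (i : Fin n → Fin (ℓ + 1)) :
      Rel F ℓ n l κ (P F r * E F i) (E F (sw r i) * P F r)
  | px (r : Fin (n - 1)) (s : Fin n) (h1 : s ≠ fa r) (h2 : s ≠ fb r) :
      Rel F ℓ n l κ (P F r * X F s) (X F s * P F r)
  | xape (r : Fin (n - 1)) (i : Fin n → Fin (ℓ + 1)) :
      Rel F ℓ n l κ (X F (fa r) * P F r * E F i)
        ((P F r * X F (fb r) - if i (fa r) = i (fb r) then 1 else 0) * E F i)
  | xbpe (r : Fin (n - 1)) (i : Fin n → Fin (ℓ + 1)) :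
      Rel F ℓ n l κ (X F (fb r) * P F r * E F i)
        ((P F r * X F (fa r) + if i (fa r) = i (fb r) then 1 else 0) * E F i)
  | ppfar (r s : Fin (n - 1)) (h : r.val + 1 < s.val) :
      Rel F ℓ n l κ (P F r * P F s) (P F s * P F r)
  | quad01 (r : Fin (n - 1)) (i : Fin n → Fin (ℓ + 1))
      (h : ((i (fa r)).val = 0 ∧ (i (fb r)).val = 1) ∨
           ((i (fa r)).val = ℓ ∧ (i (fb r)).val = ℓ - 1)) :
      Rel F ℓ n l κ (P F r ^ 2 * E F i) ((X F (fa r) + X F (fb r) ^ 2) * E F i)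
  | quad10 (r : Fin (n - 1)) (i : Fin n → Fin (ℓ + 1))
      (h : ((i (fa r)).val = 1 ∧ (i (fb r)).val = 0) ∨
           ((i (fa r)).val = ℓ - 1 ∧ (i (fb r)).val = ℓ)) :
      Rel F ℓ n l κ (P F r ^ 2 * E F i) ((X F (fa r) ^ 2 + X F (fb r)) * E F i)
  | quadAdj (r : Fin (n - 1)) (i : Fin n → Fin (ℓ + 1))
      (h : (i (fb r)).val = (i (fa r)).val + 1 ∨ (i (fa r)).val = (i (fb r)).val + 1)
      (ha0 : (i (fa r)).val ≠ 0) (hb0 : (i (fb r)).val ≠ 0)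
      (hal : (i (fa r)).val ≠ ℓ) (hbl : (i (fb r)).val ≠ ℓ) :
      Rel F ℓ n l κ (P F r ^ 2 * E F i) ((X F (fa r) + X F (fb r)) * E F i)
  | quadEq (r : Fin (n - 1)) (i : Fin n → Fin (ℓ + 1)) (h : i (fa r) = i (fb r)) :
      Rel F ℓ n l κ (P F r ^ 2 * E F i) 0
  | quadFar (r : Fin (n - 1)) (i : Fin n → Fin (ℓ + 1))
      (hne : i (fa r) ≠ i (fb r))
      (h1 : (i (fb r)).val ≠ (i (fa r)).val + 1)
      (h2 : (i (fa r)).val ≠ (i (fb r)).val + 1) :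
      Rel F ℓ n l κ (P F r ^ 2 * E F i) (E F i)
  | braidSpec (r : Fin (n - 1)) (h : r.val + 1 < n - 1) (i : Fin n → Fin (ℓ + 1))
      (heq : (i (fa r)).val = (i ⟨r.val + 2, by omega⟩).val)
      (hres : ((i (fa r)).val = 1 ∧ (i (fb r)).val = 0) ∨
              ((i (fa r)).val = ℓ - 1 ∧ (i (fb r)).val = ℓ)) :
      Rel F ℓ n l κ (P F ⟨r.val + 1, h⟩ * P F r * P F ⟨r.val + 1, h⟩ * E F i)
        ((P F r * P F ⟨r.val + 1, h⟩ * P F r + X F (fa r) + X F ⟨r.val + 2, by omega⟩) * E F i)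
  | braidAdj (r : Fin (n - 1)) (h : r.val + 1 < n - 1) (i : Fin n → Fin (ℓ + 1))
      (heq : (i (fa r)).val = (i ⟨r.val + 2, by omega⟩).val)
      (hadj : (i (fa r)).val = (i (fb r)).val + 1 ∨ (i (fb r)).val = (i (fa r)).val + 1)
      (hb0 : (i (fb r)).val ≠ 0) (hbl : (i (fb r)).val ≠ ℓ) :
      Rel F ℓ n l κ (P F ⟨r.val + 1, h⟩ * P F r * P F ⟨r.val + 1, h⟩ * E F i)
        ((P F r * P F ⟨r.val + 1, h⟩ * P F r + 1) * E F i)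
  | braidFar (r : Fin (n - 1)) (h : r.val + 1 < n - 1) (i : Fin n → Fin (ℓ + 1))
      (hno : ¬ ((i (fa r)).val = (i ⟨r.val + 2, by omega⟩).val ∧
        ((i (fa r)).val = (i (fb r)).val + 1 ∨ (i (fb r)).val = (i (fa r)).val + 1))) :
      Rel F ℓ n l κ (P F ⟨r.val + 1, h⟩ * P F r * P F ⟨r.val + 1, h⟩ * E F i)
        (P F r * P F ⟨r.val + 1, h⟩ * P F r * E F i)
  | cyc (hn : 0 < n) (i : Fin n → Fin (ℓ + 1)) :
      Rel F ℓ n l κ (X F ⟨0, hn⟩ ^ (wtMultF ℓ κ (i ⟨0, hn⟩)) * E F i) 0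

end QH

/-- The cyclotomic quiver Hecke algebra `R^Λ_n` of type `C_ℓ^(1)` over `F`, with
`Λ = Λ_κ` for the multicharge `κ`. -/
abbrev RC (F : Type) [Field F] (ℓ n l : ℕ) (κ : Fin l → ℤ) :=
  RingQuot (QH.Rel F ℓ n l κ)

namespace QH

/-- The image of `e(i)` in `R^Λ_n`. -/
def gE (F : Type) [Field F] (ℓ n l : ℕ) (κ : Fin l → ℤ)
    (i : Fin n → Fin (ℓ + 1)) : RC F ℓ n l κ :=
  RingQuot.mkAlgHom F (Rel F ℓ n l κ) (E F i)

/-- The image of `x_r` in `R^Λ_n`. -/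
def gX (F : Type) [Field F] (ℓ n l : ℕ) (κ : Fin l → ℤ) (r : Fin n) :
    RC F ℓ n l κ :=
  RingQuot.mkAlgHom F (Rel F ℓ n l κ) (X F r)

/-- The image of `ψ_r` in `R^Λ_n`. -/
def gP (F : Type) [Field F] (ℓ n l : ℕ) (κ : Fin l → ℤ) (r : Fin (n - 1)) :
    RC F ℓ n l κ :=
  RingQuot.mkAlgHom F (Rel F ℓ n l κ) (P F r)

end QH

/-- `lam` is an `l`-multipartition of `n`: an `l`-tuple of Young diagrams of total size `n`. -/
def IsMPT (l n : ℕ) (lam : Fin l → YoungDiagram) : Prop :=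
  ∑ j : Fin l, (lam j).card = n

/-- `T` is a standard tableau of shape the `l`-multipartition `lam` of `n`:
`T k` is the node (component, row, column) containing the entry `k+1`; `T` is a bijection
onto the set of nodes of `lam`, and every prefix of entries forms a Young diagram in each
component (equivalently, entries increase along rows and columns). -/
def IsStdM (l n : ℕ) (lam : Fin l → YoungDiagram) (T : Fin n → Fin l × ℕ × ℕ) : Prop :=
  Function.Injective T ∧
  (∀ (j : Fin l) (p : ℕ × ℕ), p ∈ lam j ↔ ∃ k : Fin n, T k = (j, p)) ∧
  ∀ (m : ℕ) (j : Fin l), IsLowerSet {p : ℕ × ℕ | ∃ k : Fin n, k.val < m ∧ T k = (j, p)}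

/-- The residue sequence of a tableau, valued in `I = Fin (ℓ+1)`. -/
def resSeqF (ℓ : ℕ) {l : ℕ} (n : ℕ) (κ : Fin l → ℤ) (T : Fin n → Fin l × ℕ × ℕ) :
    Fin n → Fin (ℓ + 1) :=
  fun k => barF ℓ (κ (T k).1 + ((T k).2.2 : ℤ) - ((T k).2.1 : ℤ))

/-- Condition (SS1): `⟨Λ_κ, α^∨_{i,n}⟩ ≤ 1` for all `i ∈ I`. -/
def SS1F (ℓ l n : ℕ) (κ : Fin l → ℤ) : Prop :=
  ∀ i : ℕ, i ≤ ℓ → ∀ j j' : Fin l,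
    (∃ k < n, (barF ℓ (κ j)).val = (i + k) % (ℓ + 1)) →
    (∃ k < n, (barF ℓ (κ j')).val = (i + k) % (ℓ + 1)) → j = j'

/-- Condition (SS2): `(n−1)/2 ≤ bar κ_j ≤ ℓ − (n−1)/2` for every `j`. -/
def SS2F (ℓ l n : ℕ) (κ : Fin l → ℤ) : Prop :=
  ∀ j : Fin l, (n : ℤ) - 1 ≤ 2 * (barF ℓ (κ j)).val ∧
    2 * ((barF ℓ (κ j)).val : ℤ) ≤ 2 * ℓ - ((n : ℤ) - 1)

/-- The set `I^n_Λ` of residue sequences of standard tableaux of `l`-multipartitions of `n`. -/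
def InLambda (ℓ l n : ℕ) (κ : Fin l → ℤ) : Set (Fin n → Fin (ℓ + 1)) :=
  {i | ∃ (lam : Fin l → YoungDiagram) (T : Fin n → Fin l × ℕ × ℕ),
    IsMPT l n lam ∧ IsStdM l n lam T ∧ resSeqF ℓ n κ T = i}

attribute [local instance] Classical.propDecidable

/-- The set of standard tableaux of shape `lam`. -/
abbrev STab (l n : ℕ) (lam : Fin l → YoungDiagram) : Type :=
  {T : Fin n → Fin l × ℕ × ℕ // IsStdM l n lam T}

/-- The `F`-vector space with basis `{v^t : t standard λ-tableau}`. -/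
abbrev SpechtV (F : Type) [Field F] (l n : ℕ) (lam : Fin l → YoungDiagram) : Type :=
  STab l n lam →₀ F

/-- The action of `e(i)`: `e(i) v^t = δ_{i, i^t} v^t`. -/
noncomputable def Emap (F : Type) [Field F] (ℓ l n : ℕ) (κ : Fin l → ℤ)
    (lam : Fin l → YoungDiagram) (i : Fin n → Fin (ℓ + 1)) :
    SpechtV F l n lam →ₗ[F] SpechtV F l n lam :=
  Finsupp.lsum ℕ (fun T : STab l n lam =>
    if resSeqF ℓ n κ T.val = i then (Finsupp.lsingle T : F →ₗ[F] SpechtV F l n lam) else 0)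

/-- The action of `ψ_r`: `ψ_r v^t = v^{s_r t}`, with `v^{s_r t} = 0` when `s_r t` is not
standard.  (`s_r t` swaps the entries `r` and `r+1` of `t`.) -/
noncomputable def Pmap (F : Type) [Field F] (ℓ l n : ℕ)
    (lam : Fin l → YoungDiagram) (r : Fin (n - 1)) :
    SpechtV F l n lam →ₗ[F] SpechtV F l n lam :=
  Finsupp.lsum ℕ (fun T : STab l n lam =>
    if h : IsStdM l n lam (T.val ∘ (Equiv.swap (QH.fa r) (QH.fb r))) then
      (Finsupp.lsingle (⟨_, h⟩ : STab l n lam) : F →ₗ[F] SpechtV F l n lam)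
    else 0)

namespace SpechtAux

/-! ### The folding map -/

theorem barF_spec (ℓ : ℕ) (hℓ : 1 ≤ ℓ) (m : ℤ) :
    ((barF ℓ m).val ≤ ℓ) ∧ ∃ q : ℤ, m = (barF ℓ m).val + (2 * ℓ) * q ∨
      m = -((barF ℓ m).val : ℤ) + (2 * ℓ) * q := by
  have hL : (0 : ℤ) < 2 * ℓ := by omega
  have h0 := Int.emod_nonneg m hL.ne'
  have h1 := Int.emod_lt_of_pos m hL
  have h2 := Int.emod_add_mul_ediv m (2 * ℓ)
  have hlt := (barF ℓ m).isLt
  refine ⟨by omega, ?_⟩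
  have hv : (barF ℓ m).val
      = min ((m % (2 * ℓ)).toNat) (2 * ℓ - (m % (2 * ℓ)).toNat) % (ℓ + 1) := rfl
  rw [Nat.mod_eq_of_lt (by omega)] at hv
  rw [hv]
  generalize m % (2 * ℓ) = y at *
  generalize m / (2 * ℓ) = q at *
  rcases le_total y ℓ with h | h
  · refine ⟨q, Or.inl ?_⟩
    have : ((min y.toNat (2 * ℓ - y.toNat) : ℕ) : ℤ) = y := by omega
    rw [this]; exact h2.symm
  · refine ⟨q + 1, Or.inr ?_⟩
    have : ((min y.toNat (2 * ℓ - y.toNat) : ℕ) : ℤ) = 2 * ℓ - y := by omega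
    rw [this]; rw [← h2]; ring

theorem small_mul {L q : ℤ} (h1 : -L < L * q) (h2 : L * q < L) : q = 0 := by
  have hL : 0 < L := by linarith
  have a : q < 1 := by nlinarith
  have b : -1 < q := by nlinarith
  omega

theorem barF_unique (ℓ : ℕ) (hℓ : 1 ≤ ℓ) (m : ℤ) (x : ℕ) (hx : x ≤ ℓ) (q : ℤ)
    (h : m = x + (2 * ℓ) * q ∨ m = -(x : ℤ) + (2 * ℓ) * q) : (barF ℓ m).val = x := by
  obtain ⟨hb, q', hq'⟩ := barF_spec ℓ hℓ m
  generalize (barF ℓ m).val = y at *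
  by_cases hxy : y = x
  · exact hxy
  exfalso
  have e : (2 * (ℓ : ℤ)) * (q - q') = 2 * ℓ * q - 2 * ℓ * q' := by ring
  rcases h with h | h <;> rcases hq' with h' | h'
  · have : q - q' = 0 := small_mul (L := 2 * ℓ) (by rw [e]; omega) (by rw [e]; omega)
    rw [this] at e; omega
  · have e2 : (2 * (ℓ : ℤ)) * (q - q') = -x - y := by rw [e]; linarith
    have : q - q' = 0 := small_mul (L := 2 * ℓ) (by rw [e2]; omega) (by rw [e2]; omega)
    rw [this] at e2; omega
  · have e2 : (2 * (ℓ : ℤ)) * (q - q') = x + y := by rw [e]; linarith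
    have : q - q' = 0 := small_mul (L := 2 * ℓ) (by rw [e2]; omega) (by rw [e2]; omega)
    rw [this] at e2; omega
  · have : q - q' = 0 := small_mul (L := 2 * ℓ) (by rw [e]; omega) (by rw [e]; omega)
    rw [this] at e; omega

theorem barF_succ (ℓ : ℕ) (hℓ : 1 ≤ ℓ) (m : ℤ) :
    (barF ℓ (m + 1)).val = (barF ℓ m).val + 1 ∨ (barF ℓ m).val = (barF ℓ (m + 1)).val + 1 := by
  obtain ⟨hb, q, hq⟩ := barF_spec ℓ hℓ m
  generalize (barF ℓ m).val = x at *
  rcases hq with hq | hq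
  · rcases Nat.lt_or_ge x ℓ with h | h
    · left
      exact barF_unique ℓ hℓ _ _ (by omega) q (Or.inl (by rw [hq]; push_cast; ring))
    · right
      have : x = ℓ := le_antisymm hb h
      rw [barF_unique ℓ hℓ (m + 1) (ℓ - 1) (by omega) (q + 1)
        (Or.inr (by rw [hq, this]; push_cast [hℓ]; ring))]
      omega
  · rcases Nat.eq_zero_or_pos x with h | h
    · left
      exact barF_unique ℓ hℓ _ _ (by omega) q (Or.inl (by rw [hq, h]; push_cast; ring))
    · right
      rw [barF_unique ℓ hℓ (m + 1) (x - 1) (by omega) q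
        (Or.inr (by rw [hq]; push_cast [Nat.one_le_iff_ne_zero.mpr h.ne']; ring))]
      omega

theorem barF_lip_nat (ℓ : ℕ) (hℓ : 1 ≤ ℓ) (m : ℤ) (c : ℕ) :
    (barF ℓ (m + c)).val ≤ (barF ℓ m).val + c ∧ (barF ℓ m).val ≤ (barF ℓ (m + c)).val + c := by
  induction c with
  | zero => simp
  | succ c ih =>
    have := barF_succ ℓ hℓ (m + c)
    rw [show m + ((c + 1 : ℕ) : ℤ) = m + c + 1 by push_cast; ring]
    omega

theorem barF_lip (ℓ : ℕ) (hℓ : 1 ≤ ℓ) (m : ℤ) (c : ℤ) (d : ℕ) (h1 : c ≤ d) (h2 : -c ≤ d) :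
    (barF ℓ (m + c)).val ≤ (barF ℓ m).val + d ∧ (barF ℓ m).val ≤ (barF ℓ (m + c)).val + d := by
  rcases le_total 0 c with h | h
  · obtain ⟨e, rfl⟩ := Int.eq_ofNat_of_zero_le h
    have := barF_lip_nat ℓ hℓ m e
    omega
  · obtain ⟨e, he⟩ := Int.eq_ofNat_of_zero_le (show 0 ≤ -c by omega)
    have := barF_lip_nat ℓ hℓ (m + c) e
    rw [show m + c + (e : ℤ) = m by omega] at this
    omega

/-- If `bar(m) = bar(m+2)` then `bar(m+1)` is an endpoint. -/
theorem barF_two (ℓ : ℕ) (hℓ : 2 ≤ ℓ) (m : ℤ)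
    (h : (barF ℓ m).val = (barF ℓ (m + 2)).val) :
    (barF ℓ (m + 1)).val = 0 ∨ (barF ℓ (m + 1)).val = ℓ := by
  by_contra hc
  push Not at hc
  obtain ⟨hb, q, hq⟩ := barF_spec ℓ (by omega) (m + 1)
  generalize (barF ℓ (m + 1)).val = x at *
  have hx : 1 ≤ x := by omega
  rcases hq with hq | hq
  · rw [barF_unique ℓ (by omega) m (x - 1) (by omega) q
        (Or.inl (by push_cast [hx]; linarith)),
      barF_unique ℓ (by omega) (m + 2) (x + 1) (by omega) q
        (Or.inl (by push_cast; linarith))] at h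
    omega
  · rw [barF_unique ℓ (by omega) m (x + 1) (by omega) q
        (Or.inr (by push_cast; linarith)),
      barF_unique ℓ (by omega) (m + 2) (x - 1) (by omega) q
        (Or.inr (by push_cast [hx]; linarith))] at h
    omega

/-- Separation: the residues of two incomparable nodes in the same component. -/
theorem barF_sep (ℓ : ℕ) (hℓ : 1 ≤ ℓ) (u v : ℤ)
    (hd1 : 2 ≤ u - v) (hd2 : u - v ≤ 2 * ℓ - 2)
    (q₀ : ℤ)
    (hs1 : 2 ≤ u + v + 2 * ℓ * q₀) (hs2 : u + v + 2 * ℓ * q₀ ≤ 2 * ℓ - 2) :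
    (barF ℓ u).val + 2 ≤ (barF ℓ v).val ∨ (barF ℓ v).val + 2 ≤ (barF ℓ u).val := by
  obtain ⟨hb, q, hq⟩ := barF_spec ℓ hℓ u
  obtain ⟨hb', q', hq'⟩ := barF_spec ℓ hℓ v
  generalize (barF ℓ u).val = x at *
  generalize (barF ℓ v).val = y at *
  by_contra hc
  have aux : ∀ z d : ℤ, 2 ≤ z → z ≤ 2 * ℓ - 2 → -1 ≤ d → d ≤ 1 → ∀ p : ℤ,
      z = d + 2 * ℓ * p → False := by
    intro z d h1 h2 h3 h4 p hp
    have : p = 0 ∨ p - 1 = 0 ∨ p ≤ -1 ∨ 2 ≤ p := by omega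
    rcases this with h | h | h | h
    · subst h; simp at hp; omega
    · have : p = 1 := by omega
      subst this; simp at hp; omega
    · nlinarith
    · nlinarith
  rcases hq with hq | hq <;> rcases hq' with hq' | hq'
  · exact aux (u - v) (x - y) hd1 hd2 (by omega) (by omega) (q - q') (by rw [hq, hq']; ring)
  · exact aux _ (x - y) hs1 hs2 (by omega) (by omega) (q + q' + q₀) (by rw [hq, hq']; ring)
  · exact aux _ (y - x) hs1 hs2 (by omega) (by omega) (q + q' + q₀) (by rw [hq, hq']; ring)
  · exact aux (u - v) (y - x) hd1 hd2 (by omega) (by omega) (q - q') (by rw [hq, hq']; ring)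

/-! ### Sizes of Young diagrams -/

theorem card_ge_rect (μ : YoungDiagram) (a b : ℕ) (h : (a, b) ∈ μ) :
    (a + 1) * (b + 1) ≤ μ.card := by
  have : Finset.range (a + 1) ×ˢ Finset.range (b + 1) ⊆ μ.cells := by
    rintro ⟨x, y⟩ hxy
    simp only [Finset.mem_product, Finset.mem_range] at hxy
    exact (μ.up_left_mem (by omega) (by omega) h)
  have := Finset.card_le_card this
  simpa using this

theorem card_ge_two (μ : YoungDiagram) (a b a' b' : ℕ) (h : (a, b) ∈ μ) (h' : (a', b') ∈ μ)
    (ha : a < a') (hb : b' < b) : a + a' + b + b' + 1 ≤ μ.card := by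
  obtain ⟨e, rfl⟩ : ∃ e, b = b' + 1 + e := ⟨b - b' - 1, by omega⟩
  have hdis : Disjoint (Finset.range (a' + 1) ×ˢ Finset.range (b' + 1))
      (Finset.range (a + 1) ×ˢ Finset.Ico (b' + 1) (b' + 1 + e + 1)) := by
    rw [Finset.disjoint_left]
    rintro ⟨x, y⟩ h1 h2
    simp only [Finset.mem_product, Finset.mem_range, Finset.mem_Ico] at h1 h2
    omega
  have hsub : (Finset.range (a' + 1) ×ˢ Finset.range (b' + 1)) ∪
      (Finset.range (a + 1) ×ˢ Finset.Ico (b' + 1) (b' + 1 + e + 1)) ⊆ μ.cells := by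
    rintro ⟨x, y⟩ hxy
    simp only [Finset.mem_union, Finset.mem_product, Finset.mem_range, Finset.mem_Ico] at hxy
    rcases hxy with hxy | hxy
    · exact (μ.up_left_mem (by omega) (by omega) h')
    · exact (μ.up_left_mem (by omega) (by omega) h)
  have := Finset.card_le_card hsub
  rw [Finset.card_union_of_disjoint hdis] at this
  simp only [Finset.card_product, Finset.card_range, Nat.card_Ico] at this
  rw [show b' + 1 + e + 1 - (b' + 1) = e + 1 by omega] at this
  change _ ≤ μ.cells.card
  nlinarith [Nat.zero_le (a * e), Nat.mul_le_mul_right b' (show 1 ≤ a' by omega)]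

/-! ### Comparability and standardness -/

/-- `A` lies weakly north-west of `B` in the same component. -/
def Cmp {l : ℕ} (A B : Fin l × ℕ × ℕ) : Prop := A.1 = B.1 ∧ A.2 ≤ B.2

/-- The (unfolded) residue of a node. -/
def rs (ℓ : ℕ) {l : ℕ} (κ : Fin l → ℤ) (A : Fin l × ℕ × ℕ) : ℕ :=
  (barF ℓ (κ A.1 + (A.2.2 : ℤ) - (A.2.1 : ℤ))).val

theorem rs_sep (ℓ n l : ℕ) (hℓ : 2 ≤ ℓ) (hn : 2 ≤ n)
    (κ : Fin l → ℤ) (h1 : SS1F ℓ l n κ) (h2 : SS2F ℓ l n κ)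
    (lam : Fin l → YoungDiagram) (hlam : IsMPT l n lam) (A B : Fin l × ℕ × ℕ)
    (hA : A.2 ∈ lam A.1) (hB : B.2 ∈ lam B.1) (hAB : ¬ Cmp A B) (hBA : ¬ Cmp B A) :
    rs ℓ κ A + 2 ≤ rs ℓ κ B ∨ rs ℓ κ B + 2 ≤ rs ℓ κ A := by
  have same : ∀ (j : Fin l) (a b a' b' : ℕ), (a, b) ∈ lam j → (a', b') ∈ lam j →
      a < a' → b' < b →
      rs ℓ κ (j, a, b) + 2 ≤ rs ℓ κ (j, a', b') ∨ rs ℓ κ (j, a', b') + 2 ≤ rs ℓ κ (j, a, b) := by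
    intro j a b a' b' h h' ha hb
    have hc := card_ge_two (lam j) a b a' b' h h' ha hb
    have hle : (lam j).card ≤ n := by
      rw [← hlam]
      exact Finset.single_le_sum (f := fun j => (lam j).card) (fun _ _ => Nat.zero_le _)
        (Finset.mem_univ j)
    obtain ⟨hk1, hk2⟩ := h2 j
    obtain ⟨hb, q, hq⟩ := barF_spec ℓ (by omega) (κ j)
    unfold rs
    generalize (barF ℓ (κ j)).val = k at *
    dsimp only
    rcases hq with hq | hq
    · have e : (κ j + (b:ℤ) - a) + (κ j + (b':ℤ) - a') + 2 * ℓ * (-(2 * q))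
          = 2 * k + b + b' - a - a' := by rw [hq]; ring
      exact barF_sep ℓ (by omega) _ _ (by omega) (by omega) (-(2 * q)) (by omega) (by omega)
    · have e : (κ j + (b:ℤ) - a) + (κ j + (b':ℤ) - a') + 2 * ℓ * (-(2 * q) + 1)
          = 2 * ℓ - 2 * k + b + b' - a - a' := by rw [hq]; ring
      exact barF_sep ℓ (by omega) _ _ (by omega) (by omega) (-(2 * q) + 1) (by omega) (by omega)
  obtain ⟨j, a, b⟩ := A
  obtain ⟨j', a', b'⟩ := B
  simp only [Cmp, Prod.mk_le_mk, not_and, not_le] at *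
  by_cases hj : j = j'
  · subst hj
    have hAB := hAB rfl
    have hBA := hBA rfl
    rcases Nat.lt_trichotomy a a' with h | h | h
    · exact same j a b a' b' hA hB h (hAB h.le)
    · have := hAB h.le
      have := hBA h.ge
      omega
    · exact (same j a' b' a b hB hA h (hBA h.le)).symm
  · have hc : (lam j).card + (lam j').card ≤ n := by
      rw [← hlam, ← Finset.sum_pair (f := fun j => (lam j).card) hj]
      exact Finset.sum_le_sum_of_subset (Finset.subset_univ _)
    have c1 := card_ge_rect _ _ _ hA
    have c2 := card_ge_rect _ _ _ hB
    have d1 : a + b + 1 ≤ (lam j).card := by nlinarith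
    have d2 : a' + b' + 1 ≤ (lam j').card := by nlinarith
    have far : ∀ i i' : Fin l, i ≠ i' → (barF ℓ (κ i)).val ≤ (barF ℓ (κ i')).val →
        (barF ℓ (κ i)).val + n ≤ (barF ℓ (κ i')).val := by
      intro i i' hne hle
      by_contra hlt
      apply hne
      have b1 := (barF ℓ (κ i)).isLt
      have b2 := (barF ℓ (κ i')).isLt
      refine h1 (barF ℓ (κ i)).val (by omega) i i' ⟨0, by omega, ?_⟩
        ⟨(barF ℓ (κ i')).val - (barF ℓ (κ i)).val, by omega, ?_⟩
      · rw [Nat.mod_eq_of_lt (by omega)]; rfl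
      · rw [Nat.mod_eq_of_lt (by omega)]; omega
    have l1 := barF_lip ℓ (by omega) (κ j) ((b : ℤ) - a) (a + b) (by omega) (by omega)
    have l2 := barF_lip ℓ (by omega) (κ j') ((b' : ℤ) - a') (a' + b') (by omega) (by omega)
    unfold rs
    dsimp only
    rw [add_sub_assoc, add_sub_assoc]
    rcases le_total (barF ℓ (κ j)).val (barF ℓ (κ j')).val with h | h
    · have := far j j' hj h
      omega
    · have := far j' j (Ne.symm hj) h
      omega

theorem std_iff {l n : ℕ} {lam : Fin l → YoungDiagram} {T : Fin n → Fin l × ℕ × ℕ} :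
    IsStdM l n lam T ↔ Function.Injective T ∧
      (∀ (j : Fin l) (p : ℕ × ℕ), p ∈ lam j ↔ ∃ k : Fin n, T k = (j, p)) ∧
      ∀ k k' : Fin n, Cmp (T k) (T k') → k ≤ k' := by
  unfold IsStdM
  refine and_congr_right fun hinj => and_congr_right fun hr => ⟨fun h k k' hc => ?_, ?_⟩
  · have := @h (k'.val + 1) (T k').1 (T k').2 (T k).2 hc.2 ⟨k', by omega, rfl⟩
    obtain ⟨k'', hk, he⟩ := this
    have : k'' = k := hinj (by rw [he, ← hc.1])
    subst this
    exact Fin.le_def.mpr (by omega)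
  · rintro h m j p q hqp ⟨k, hk, hT⟩
    have hp : p ∈ lam j := (hr j p).2 ⟨k, hT⟩
    have hq : q ∈ lam j := (lam j).isLowerSet hqp hp
    obtain ⟨k', hk'⟩ := (hr j q).1 hq
    refine ⟨k', lt_of_le_of_lt (h k' k ?_) hk, hk'⟩
    rw [hk', hT]
    exact ⟨rfl, hqp⟩

theorem std_mem {l n : ℕ} {lam : Fin l → YoungDiagram} {T : Fin n → Fin l × ℕ × ℕ}
    (h : IsStdM l n lam T) (k : Fin n) : (T k).2 ∈ lam (T k).1 :=
  (h.2.1 _ _).2 ⟨k, rfl⟩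

/-- `s_r` as a permutation. -/
abbrev sg {n : ℕ} (r : Fin (n - 1)) : Equiv.Perm (Fin n) := Equiv.swap (QH.fa r) (QH.fb r)

theorem std_swap {l n : ℕ} {lam : Fin l → YoungDiagram} {T : Fin n → Fin l × ℕ × ℕ}
    (h : IsStdM l n lam T) (r : Fin (n - 1)) :
    IsStdM l n lam (T ∘ sg r) ↔ ¬ Cmp (T (QH.fa r)) (T (QH.fb r)) := by
  rw [std_iff] at h ⊢
  constructor
  · rintro ⟨-, -, h3⟩ hc
    have := h3 (QH.fb r) (QH.fa r) (by simpa [sg] using hc)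
    simp [QH.fa, QH.fb, Fin.le_def] at this
  · intro hc
    refine ⟨h.1.comp (sg r).injective, fun j p => ?_, fun k k' hk => ?_⟩
    · rw [h.2.1 j p]
      constructor
      · rintro ⟨k, hk⟩
        exact ⟨sg r k, by simpa [sg] using hk⟩
      · rintro ⟨k, hk⟩
        exact ⟨sg r k, hk⟩
    · by_contra hlt
      have hle := h.2.2 _ _ hk
      have : k' = QH.fa r ∧ k = QH.fb r := by
        have hv : ∀ x : Fin n, (sg r x).val =
            if x.val = r.val then r.val + 1 else if x.val = r.val + 1 then r.val else x.val := by
          intro x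
          simp only [sg, Equiv.swap_apply_def, Fin.ext_iff, QH.fa, QH.fb]
          split_ifs <;> rfl
        rw [Fin.le_def, hv, hv] at hle
        simp only [QH.fa, QH.fb, Fin.ext_iff, Fin.le_def] at hlt ⊢
        split_ifs at hle <;> omega
      obtain ⟨rfl, rfl⟩ := this
      apply hc
      simpa [sg] using hk

/-- Comparable consecutive nodes are adjacent. -/
theorem std_cover {l n : ℕ} {lam : Fin l → YoungDiagram} {T : Fin n → Fin l × ℕ × ℕ}
    (h : IsStdM l n lam T) (k k' : Fin n) (hk : k'.val = k.val + 1) (hc : Cmp (T k) (T k')) :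
    (T k') = ((T k).1, (T k).2.1 + 1, (T k).2.2) ∨
    (T k') = ((T k).1, (T k).2.1, (T k).2.2 + 1) := by
  have hmem := std_mem h k'
  have hne : T k ≠ T k' := fun e => by
    have := h.1 e
    subst this
    omega
  rw [std_iff] at h
  obtain ⟨hinj, hr, hord⟩ := h
  have key : ∀ q : ℕ × ℕ, (T k).2 ≤ q → q ≤ (T k').2 → q = (T k).2 ∨ q = (T k').2 := by
    intro q hq1 hq2
    have hqm : q ∈ lam (T k').1 := (lam (T k').1).isLowerSet hq2 hmem
    obtain ⟨m, hm⟩ := (hr _ _).1 hqm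
    have a1 : k ≤ m := hord _ _ (by rw [hm]; exact ⟨hc.1, hq1⟩)
    have a2 : m ≤ k' := hord _ _ (by rw [hm]; exact ⟨rfl, hq2⟩)
    rw [Fin.le_def] at a1 a2
    rcases (show m.val = k.val ∨ m.val = k'.val by omega) with e | e
    · left; rw [← Fin.ext e, hm]
    · right; rw [← Fin.ext e, hm]
  obtain ⟨hj, hle⟩ := hc
  generalize T k = A at *
  generalize T k' = B at *
  obtain ⟨j, a, b⟩ := A
  obtain ⟨j', a', b'⟩ := B
  dsimp only at *
  subst hj
  simp only [Prod.mk_le_mk, Prod.forall, Prod.mk.injEq] at *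
  rcases Nat.lt_or_ge a a' with hlt | hge
  · have := key (a + 1) b (by omega) (by omega)
    left; refine ⟨trivial, by omega, by omega⟩
  · have hb : b < b' := by
      by_contra hb
      exact hne (by simp; omega)
    have := key a (b + 1) (by omega) (by omega)
    right; refine ⟨trivial, by omega, by omega⟩

theorem not_cmp_succ {l n : ℕ} {lam : Fin l → YoungDiagram} {T : Fin n → Fin l × ℕ × ℕ}
    (h : IsStdM l n lam T) (k k' : Fin n) (hk : k < k') : ¬ Cmp (T k') (T k) := by
  intro hc
  have := (std_iff.1 h).2.2 _ _ hc
  exact absurd this (not_le.mpr hk)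

section residues

variable {ℓ n l : ℕ} {κ : Fin l → ℤ} {lam : Fin l → YoungDiagram} {T : Fin n → Fin l × ℕ × ℕ}

theorem rs_cover (ℓ l : ℕ) (hℓ : 2 ≤ ℓ) (κ : Fin l → ℤ) (A B : Fin l × ℕ × ℕ)
    (h : B = (A.1, A.2.1 + 1, A.2.2) ∨ B = (A.1, A.2.1, A.2.2 + 1)) :
    rs ℓ κ B = rs ℓ κ A + 1 ∨ rs ℓ κ A = rs ℓ κ B + 1 := by
  unfold rs
  rcases h with rfl | rfl
  · have := barF_succ ℓ (by omega) (κ A.1 + A.2.2 - (A.2.1 + 1 : ℕ))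
    rw [show κ A.1 + A.2.2 - ((A.2.1 + 1 : ℕ) : ℤ) + 1 = κ A.1 + A.2.2 - A.2.1 by
      push_cast; ring] at this
    exact this.symm
  · have := barF_succ ℓ (by omega) (κ A.1 + A.2.2 - A.2.1)
    rw [show κ A.1 + A.2.2 - (A.2.1 : ℤ) + 1 = κ A.1 + (A.2.2 + 1 : ℕ) - A.2.1 by
      push_cast; ring] at this
    exact this

theorem res_cases (hℓ : 2 ≤ ℓ) (hn : 2 ≤ n) (h1 : SS1F ℓ l n κ) (h2 : SS2F ℓ l n κ)
    (hlam : IsMPT l n lam) (h : IsStdM l n lam T) (k k' : Fin n) (hk : k'.val = k.val + 1) :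
    (Cmp (T k) (T k') ∧ (rs ℓ κ (T k') = rs ℓ κ (T k) + 1 ∨ rs ℓ κ (T k) = rs ℓ κ (T k') + 1)) ∨
    (¬ Cmp (T k) (T k') ∧
      (rs ℓ κ (T k) + 2 ≤ rs ℓ κ (T k') ∨ rs ℓ κ (T k') + 2 ≤ rs ℓ κ (T k))) := by
  by_cases hc : Cmp (T k) (T k')
  · exact Or.inl ⟨hc, rs_cover ℓ l hℓ κ _ _ (std_cover h k k' hk hc)⟩
  · refine Or.inr ⟨hc, ?_⟩
    exact rs_sep ℓ n l hℓ hn κ h1 h2 lam hlam _ _ (std_mem h _) (std_mem h _) hc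
      (not_cmp_succ h _ _ (Fin.lt_def.mpr (by omega)))

/-- Three consecutive nodes, each comparable with the next, with equal outer residues:
the middle residue is `0` or `ℓ`. -/
theorem res_three (hℓ : 2 ≤ ℓ) (h : IsStdM l n lam T) (a b c : Fin n) (hb : b.val = a.val + 1)
    (hc : c.val = b.val + 1) (hab : Cmp (T a) (T b)) (hbc : Cmp (T b) (T c))
    (he : rs ℓ κ (T a) = rs ℓ κ (T c)) : rs ℓ κ (T b) = 0 ∨ rs ℓ κ (T b) = ℓ := by
  have c1 := std_cover h a b hb hab
  have c2 := std_cover h b c hc hbc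
  have hmem := std_mem h c
  obtain ⟨hinj, hr, hord⟩ := std_iff.1 h
  have nomid : ∀ q : ℕ × ℕ, (T a).2 ≤ q → q ≤ (T c).2 → q = (T a).2 ∨ q = (T b).2
      ∨ q = (T c).2 := by
    intro q hq1 hq2
    have hqm : q ∈ lam (T c).1 := (lam (T c).1).isLowerSet hq2 hmem
    obtain ⟨m, hm⟩ := (hr _ _).1 hqm
    have a1 : a ≤ m := hord _ _ (by rw [hm]; exact ⟨hab.1.trans hbc.1, hq1⟩)
    have a2 : m ≤ c := hord _ _ (by rw [hm]; exact ⟨rfl, hq2⟩)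
    rw [Fin.le_def] at a1 a2
    rcases (show m.val = a.val ∨ m.val = b.val ∨ m.val = c.val by omega) with e | e | e
    · left; rw [← Fin.ext e, hm]
    · right; left; rw [← Fin.ext e, hm]
    · right; right; rw [← Fin.ext e, hm]
  generalize T a = A at *
  generalize T b = B at *
  generalize T c = C at *
  obtain ⟨j, x, y⟩ := A
  unfold rs at *
  rcases c1 with rfl | rfl <;> rcases c2 with rfl | rfl <;> dsimp only at *
  · have := barF_two ℓ hℓ (κ j + y - (x + 1 + 1 : ℕ)) (by
      rw [← he]; congr 2; push_cast; ring)
    rw [show κ j + y - ((x + 1 + 1 : ℕ) : ℤ) + 1 = κ j + y - (x + 1 : ℕ) by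
      push_cast; ring] at this
    exact this
  · have := nomid (x, y + 1) (by simp) (by simp)
    simp at this
  · have := nomid (x + 1, y) (by simp) (by simp)
    simp at this
  · have := barF_two ℓ hℓ (κ j + y - x) (by
      rw [he]; congr 2; push_cast; ring)
    rw [show κ j + y - (x : ℤ) + 1 = κ j + (y + 1 : ℕ) - x by
      push_cast; ring] at this
    exact this

/-- Distinct standard tableaux have distinct residue sequences. -/
theorem res_inj (hℓ : 2 ≤ ℓ) (hn : 2 ≤ n) (h1 : SS1F ℓ l n κ) (h2 : SS2F ℓ l n κ)
    (hlam : IsMPT l n lam) {S : Fin n → Fin l × ℕ × ℕ} (hT : IsStdM l n lam T) (hS : IsStdM l n lam S)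
    (he : ∀ k, rs ℓ κ (T k) = rs ℓ κ (S k)) : T = S := by
  funext k
  induction k using WellFoundedLT.induction with
  | ind k ih =>
  by_contra hne
  have aux : ∀ T S : Fin n → Fin l × ℕ × ℕ, IsStdM l n lam T → IsStdM l n lam S →
      (∀ m < k, T m = S m) → T k ≠ S k → ¬ Cmp (T k) (S k) := by
    intro T S hT hS ih hne hc
    obtain ⟨m, hm⟩ := (hS.2.1 (T k).1 (T k).2).1 (std_mem hT k)
    have hm : S m = T k := hm
    have hle : m ≤ k := (std_iff.1 hS).2.2 m k (by rw [hm]; exact hc)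
    rcases hle.lt_or_eq with hlt | rfl
    · have := ih m hlt
      rw [hm] at this
      exact hlt.ne (hT.1 this)
    · exact hne hm.symm
  have := rs_sep ℓ n l hℓ hn κ h1 h2 lam hlam _ _ (std_mem hT k) (std_mem hS k)
    (aux T S hT hS ih hne) (aux S T hS hT (fun m hm => (ih m hm).symm) (Ne.symm hne))
  have := he k
  omega

end residues

/-! ### Existence of a standard tableau -/

theorem exists_std {l n : ℕ} (lam : Fin l → YoungDiagram) (hlam : IsMPT l n lam) :
    ∃ T, IsStdM l n lam T := by
  let emb : Fin l × ℕ × ℕ → Fin l ×ₗ (ℕ ×ₗ ℕ) := fun A => toLex (A.1, toLex A.2)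
  let bk : Fin l ×ₗ (ℕ ×ₗ ℕ) → Fin l × ℕ × ℕ := fun A => ((ofLex A).1, ofLex (ofLex A).2)
  have hbe : ∀ A, bk (emb A) = A := fun A => rfl
  have heb : ∀ A, emb (bk A) = A := fun A => rfl
  have hinj : Function.Injective emb := Function.LeftInverse.injective hbe
  let N : Finset (Fin l × ℕ × ℕ) :=
    (Finset.univ.sigma fun j => (lam j).cells).map
      ⟨fun s => (s.1, s.2), by
        rintro ⟨a, b⟩ ⟨c, d⟩ h
        simp only [Prod.mk.injEq] at h
        obtain ⟨rfl, rfl⟩ := h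
        rfl⟩
  have hN : ∀ j p, (j, p) ∈ N ↔ p ∈ lam j := by
    intro j p
    simp only [N, Finset.mem_map, Finset.mem_sigma, Finset.mem_univ, true_and]
    constructor
    · rintro ⟨⟨a, b⟩, h, he⟩
      obtain ⟨rfl, rfl⟩ := Prod.mk.inj he
      exact h
    · intro h
      exact ⟨⟨j, p⟩, h, rfl⟩
  have hcard : (N.map ⟨emb, hinj⟩).card = n := by
    rw [Finset.card_map, Finset.card_map, Finset.card_sigma]
    exact hlam
  let o := (N.map ⟨emb, hinj⟩).orderIsoOfFin hcard
  have hmono : ∀ A B : Fin l × ℕ × ℕ, Cmp A B → emb A ≤ emb B := by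
    rintro ⟨j, a, b⟩ ⟨j', a', b'⟩ ⟨h1, h2⟩
    dsimp only at h1
    subst h1
    simp only [Prod.mk_le_mk] at h2
    simp only [emb, Prod.Lex.toLex_le_toLex]
    right
    refine ⟨trivial, ?_⟩
    omega
  refine ⟨fun k => bk (o k).val, std_iff.2 ⟨?_, ?_, ?_⟩⟩
  · intro k k' h
    have : emb (bk (o k).val) = emb (bk (o k').val) := congrArg emb h
    rw [heb, heb] at this
    exact o.injective (Subtype.ext this)
  · intro j p
    rw [← hN]
    constructor
    · intro h
      refine ⟨o.symm ⟨emb (j, p), Finset.mem_map_of_mem _ h⟩, ?_⟩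
      rw [OrderIso.apply_symm_apply]
      rfl
    · rintro ⟨k, hk⟩
      have := (o k).2
      obtain ⟨A, hA, hA'⟩ := Finset.mem_map.1 this
      rw [← hk, ← hA']
      exact hA
  · intro k k' h
    have := hmono _ _ h
    rw [heb, heb] at this
    exact o.le_iff_le.1 this

/-! ### Connectivity -/

theorem connected {l n : ℕ} {lam : Fin l → YoungDiagram} (Q : (Fin n → Fin l × ℕ × ℕ) → Prop)
    (hQ : ∀ S r, IsStdM l n lam S → IsStdM l n lam (S ∘ sg r) → Q S → Q (S ∘ sg r))
    {T : Fin n → Fin l × ℕ × ℕ} (hT : IsStdM l n lam T) :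
    ∀ (e d : ℕ) (S : Fin n → Fin l × ℕ × ℕ), IsStdM l n lam S → Q S →
      ∀ m : Fin n, m.val + e + 1 = n → (∀ k < m, S k = T k) →
      ∀ p : Fin n, p.val = m.val + d → S p = T m → Q T := by
  intro e
  induction e with
  | zero =>
    intro d S hS hQS m hm hk p hp hpm
    have : S = T := by
      funext k
      by_cases hlt : k < m
      · exact hk k hlt
      · have e1 : k = m := Fin.ext (by rw [Fin.lt_def] at hlt; omega)
        have e2 : p = m := Fin.ext (by omega)
        rw [e1, ← hpm, e2]
    rw [← this]; exact hQS
  | succ e ihe =>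
    intro d
    induction d with
    | zero =>
      intro S hS hQS m hm hk p hp hpm
      have e2 : p = m := Fin.ext (by omega)
      subst e2
      have hm' : p.val + 1 < n := by omega
      obtain ⟨p', hp'⟩ := (hS.2.1 (T ⟨p.val + 1, hm'⟩).1 (T ⟨p.val + 1, hm'⟩).2).1
        (std_mem hT _)
      have hp' : S p' = T ⟨p.val + 1, hm'⟩ := hp'
      have hk' : ∀ k < (⟨p.val + 1, hm'⟩ : Fin n), S k = T k := by
        intro k hlt
        rw [Fin.lt_def] at hlt
        dsimp only at hlt
        rcases Nat.lt_or_ge k.val p.val with h | h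
        · exact hk k h
        · have : k = p := Fin.ext (by omega)
          rw [this, hpm]
      have hge : p.val + 1 ≤ p'.val := by
        by_contra hlt
        have := hk' p' (Fin.lt_def.mpr (by simpa using hlt))
        rw [hp'] at this
        have := hT.1 this
        rw [← this] at hlt
        simp at hlt
      exact ihe (p'.val - (p.val + 1)) S hS hQS ⟨p.val + 1, hm'⟩ (by simp; omega) hk' p'
        (by simp; omega) hp'
    | succ d ihd =>
      intro S hS hQS m hm hk p hp hpm
      have hpn := p.isLt
      let r : Fin (n - 1) := ⟨m.val + d, by omega⟩
      have hfb : QH.fb r = p := Fin.ext (by simp [QH.fb, r]; omega)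
      have hfa : (QH.fa r).val = m.val + d := rfl
      have hstd : IsStdM l n lam (S ∘ sg r) := by
        rw [std_swap hS]
        intro hc
        rw [hfb, hpm] at hc
        -- the node `S (fa r)` lies before `T m`, hence is in the common prefix
        obtain ⟨k, hk1⟩ := (hT.2.1 (S (QH.fa r)).1 (S (QH.fa r)).2).1 (std_mem hS _)
        have hk1 : T k = S (QH.fa r) := hk1
        have hle : k ≤ m := (std_iff.1 hT).2.2 k m (by rw [hk1]; exact hc)
        rcases hle.lt_or_eq with hlt | rfl
        · have := hk k hlt
          rw [hk1] at this
          have := hS.1 this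
          rw [this, Fin.lt_def] at hlt
          omega
        · rw [← hpm] at hk1
          have := hS.1 hk1
          rw [← this] at hfa
          omega
      refine ihd (S ∘ sg r) hstd (hQ S r hS hstd hQS) m hm ?_ (QH.fa r) hfa ?_
      · intro k hlt
        rw [← hk k hlt]
        simp only [Function.comp, sg]
        rw [Equiv.swap_apply_of_ne_of_ne]
        · intro h; rw [h, Fin.lt_def] at hlt; omega
        · intro h; rw [h, hfb, Fin.lt_def] at hlt; omega
      · simp only [Function.comp, sg, Equiv.swap_apply_left, hfb, hpm]

theorem connected' {l n : ℕ} (hn : 0 < n) {lam : Fin l → YoungDiagram}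
    (Q : (Fin n → Fin l × ℕ × ℕ) → Prop)
    (hQ : ∀ S r, IsStdM l n lam S → IsStdM l n lam (S ∘ sg r) → Q S → Q (S ∘ sg r))
    {S T : Fin n → Fin l × ℕ × ℕ} (hS : IsStdM l n lam S) (hT : IsStdM l n lam T)
    (h : Q S) : Q T := by
  obtain ⟨p, hp⟩ := (hS.2.1 (T ⟨0, hn⟩).1 (T ⟨0, hn⟩).2).1 (std_mem hT _)
  exact connected Q hQ hT (n - 1) p.val S hS h ⟨0, hn⟩ (by simp; omega)
    (fun k hk => absurd hk (by simp [Fin.lt_def])) p (by simp) hp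

/-! ### The action on basis vectors -/

section action

variable {F : Type} [Field F] {ℓ n l : ℕ} {κ : Fin l → ℤ} {lam : Fin l → YoungDiagram}

/-- The basis vector `v^t`, zero if `t` is not standard. -/
noncomputable def vv (F : Type) [Field F] (lam : Fin l → YoungDiagram)
    (t : Fin n → Fin l × ℕ × ℕ) : SpechtV F l n lam :=
  if h : IsStdM l n lam t then Finsupp.single ⟨t, h⟩ 1 else 0

theorem vv_std {t : Fin n → Fin l × ℕ × ℕ} (h : IsStdM l n lam t) :
    vv F lam t = Finsupp.single ⟨t, h⟩ 1 := dif_pos h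

theorem E_vv {t : Fin n → Fin l × ℕ × ℕ} (h : IsStdM l n lam t) (i : Fin n → Fin (ℓ + 1)) :
    Emap F ℓ l n κ lam i (vv F lam t) = if resSeqF ℓ n κ t = i then vv F lam t else 0 := by
  rw [vv_std h, Emap, Finsupp.lsum_single]
  by_cases hi : resSeqF ℓ n κ t = i
  · rw [if_pos hi, if_pos hi]; rfl
  · rw [if_neg hi, if_neg hi]; rfl

theorem P_vv {t : Fin n → Fin l × ℕ × ℕ} (h : IsStdM l n lam t) (r : Fin (n - 1)) :
    Pmap F ℓ l n lam r (vv F lam t) =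
      if Cmp (t (QH.fa r)) (t (QH.fb r)) then 0 else vv F lam (t ∘ sg r) := by
  rw [vv_std h, Pmap, Finsupp.lsum_single]
  by_cases hc : Cmp (t (QH.fa r)) (t (QH.fb r))
  · rw [if_pos hc, dif_neg]
    · rfl
    · rw [std_swap h r]; exact not_not.mpr hc
  · have hs := (std_swap h r).2 hc
    rw [if_neg hc, dif_pos hs, vv_std hs]
    rfl

theorem end_ext {f g : Module.End F (SpechtV F l n lam)}
    (h : ∀ t, IsStdM l n lam t → f (vv F lam t) = g (vv F lam t)) : f = g := by
  apply Finsupp.lhom_ext'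
  rintro ⟨t, ht⟩
  ext
  have := h t ht
  rw [vv_std ht] at this
  simp [this]

theorem mulE_ext {f g : Module.End F (SpechtV F l n lam)} {i : Fin n → Fin (ℓ + 1)}
    (h : ∀ t, IsStdM l n lam t → resSeqF ℓ n κ t = i → f (vv F lam t) = g (vv F lam t)) :
    f * Emap F ℓ l n κ lam i = g * Emap F ℓ l n κ lam i := by
  apply end_ext
  intro t ht
  rw [Module.End.mul_apply, Module.End.mul_apply, E_vv ht]
  split_ifs with hi
  · exact h t ht hi
  · simp

theorem P_braid {t : Fin n → Fin l × ℕ × ℕ} (h : IsStdM l n lam t) (r s : Fin (n - 1))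
    (hs : s.val = r.val + 1) :
    Pmap F ℓ l n lam s (Pmap F ℓ l n lam r (Pmap F ℓ l n lam s (vv F lam t))) =
    Pmap F ℓ l n lam r (Pmap F ℓ l n lam s (Pmap F ℓ l n lam r (vv F lam t))) := by
  obtain ⟨a, ha⟩ : ∃ a, QH.fa r = a := ⟨_, rfl⟩
  obtain ⟨b, hb⟩ : ∃ b, QH.fb r = b := ⟨_, rfl⟩
  obtain ⟨c, hc⟩ : ∃ c, QH.fb s = c := ⟨_, rfl⟩
  have hb' : QH.fa s = b := by rw [← hb]; exact Fin.ext hs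
  have hab : a ≠ b := by rw [← ha, ← hb]; simp [QH.fa, QH.fb, Fin.ext_iff]
  have hbc : b ≠ c := by rw [← hb', ← hc]; simp [QH.fa, QH.fb, Fin.ext_iff]
  have hac : a ≠ c := by rw [← ha, ← hc]; simp [QH.fa, QH.fb, Fin.ext_iff]; omega
  have er : sg r = Equiv.swap a b := by rw [← ha, ← hb]
  have es : sg s = Equiv.swap b c := by rw [← hb', ← hc]
  have r1 : ∀ u, IsStdM l n lam u → Pmap F ℓ l n lam r (vv F lam u) =
      if Cmp (u a) (u b) then 0 else vv F lam (u ∘ Equiv.swap a b) := by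
    intro u hu; rw [P_vv hu, er, ha, hb]
  have s1 : ∀ u, IsStdM l n lam u → Pmap F ℓ l n lam s (vv F lam u) =
      if Cmp (u b) (u c) then 0 else vv F lam (u ∘ Equiv.swap b c) := by
    intro u hu; rw [P_vv hu, es, hb', hc]
  have r2 : ∀ u, IsStdM l n lam u → ¬ Cmp (u a) (u b) →
      IsStdM l n lam (u ∘ Equiv.swap a b) := by
    intro u hu hh; rw [← er, std_swap hu, ha, hb]; exact hh
  have s2 : ∀ u, IsStdM l n lam u → ¬ Cmp (u b) (u c) →
      IsStdM l n lam (u ∘ Equiv.swap b c) := by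
    intro u hu hh; rw [← es, std_swap hu, hb', hc]; exact hh
  have va : Equiv.swap b c a = a := Equiv.swap_apply_of_ne_of_ne hab hac
  have vc : Equiv.swap a b c = c := Equiv.swap_apply_of_ne_of_ne hac.symm hbc.symm
  have L : Pmap F ℓ l n lam s (Pmap F ℓ l n lam r (Pmap F ℓ l n lam s (vv F lam t))) =
      if Cmp (t b) (t c) ∨ Cmp (t a) (t c) ∨ Cmp (t a) (t b) then 0 else
        vv F lam (((t ∘ Equiv.swap b c) ∘ Equiv.swap a b) ∘ Equiv.swap b c) := by
    rw [s1 t h]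
    by_cases h1 : Cmp (t b) (t c)
    · simp [h1]
    have t1 := s2 t h h1
    rw [if_neg h1, r1 _ t1]
    by_cases h2 : Cmp (t a) (t c)
    · simp [va, h2]
    have h2' : ¬ Cmp ((t ∘ Equiv.swap b c) a) ((t ∘ Equiv.swap b c) b) := by simpa [va] using h2
    have t2 := r2 _ t1 h2'
    rw [if_neg h2', s1 _ t2]
    by_cases h3 : Cmp (t a) (t b)
    · simp [va, vc, h3]
    · simp [va, vc, h1, h2, h3]
  have R : Pmap F ℓ l n lam r (Pmap F ℓ l n lam s (Pmap F ℓ l n lam r (vv F lam t))) =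
      if Cmp (t b) (t c) ∨ Cmp (t a) (t c) ∨ Cmp (t a) (t b) then 0 else
        vv F lam (((t ∘ Equiv.swap a b) ∘ Equiv.swap b c) ∘ Equiv.swap a b) := by
    rw [r1 t h]
    by_cases h1 : Cmp (t a) (t b)
    · simp [h1]
    have t1 := r2 t h h1
    rw [if_neg h1, s1 _ t1]
    by_cases h2 : Cmp (t a) (t c)
    · simp [vc, h2]
    have h2' : ¬ Cmp ((t ∘ Equiv.swap a b) b) ((t ∘ Equiv.swap a b) c) := by simpa [vc] using h2
    have t2 := s2 _ t1 h2'
    rw [if_neg h2', r1 _ t2]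
    by_cases h3 : Cmp (t b) (t c)
    · simp [va, vc, h3]
    · simp [va, vc, h1, h2, h3]
  rw [L, R]
  congr 2
  funext k
  simp only [Function.comp]
  congr 1
  simp only [Equiv.swap_apply_def]
  split_ifs <;> simp_all

theorem P_far {t : Fin n → Fin l × ℕ × ℕ} (h : IsStdM l n lam t) (r s : Fin (n - 1))
    (hs : r.val + 1 < s.val) :
    Pmap F ℓ l n lam r (Pmap F ℓ l n lam s (vv F lam t)) =
    Pmap F ℓ l n lam s (Pmap F ℓ l n lam r (vv F lam t)) := by
  have n1 : QH.fa r ≠ QH.fa s := by simp [QH.fa, Fin.ext_iff]; omega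
  have n2 : QH.fa r ≠ QH.fb s := by simp [QH.fa, QH.fb, Fin.ext_iff]; omega
  have n3 : QH.fb r ≠ QH.fa s := by simp [QH.fa, QH.fb, Fin.ext_iff]; omega
  have n4 : QH.fb r ≠ QH.fb s := by simp [QH.fb, Fin.ext_iff]; omega
  have e1 : sg s (QH.fa r) = QH.fa r := Equiv.swap_apply_of_ne_of_ne n1 n2
  have e2 : sg s (QH.fb r) = QH.fb r := Equiv.swap_apply_of_ne_of_ne n3 n4
  have e3 : sg r (QH.fa s) = QH.fa s := Equiv.swap_apply_of_ne_of_ne n1.symm n3.symm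
  have e4 : sg r (QH.fb s) = QH.fb s := Equiv.swap_apply_of_ne_of_ne n2.symm n4.symm
  have L : ∀ r s : Fin (n - 1), sg s (QH.fa r) = QH.fa r → sg s (QH.fb r) = QH.fb r →
      Pmap F ℓ l n lam r (Pmap F ℓ l n lam s (vv F lam t)) =
      if Cmp (t (QH.fa s)) (t (QH.fb s)) ∨ Cmp (t (QH.fa r)) (t (QH.fb r)) then 0
      else vv F lam ((t ∘ sg s) ∘ sg r) := by
    intro r s e1 e2
    rw [P_vv h]
    by_cases h1 : Cmp (t (QH.fa s)) (t (QH.fb s))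
    · simp [h1]
    · have t1 := (std_swap h s).2 h1
      rw [if_neg h1, P_vv t1]
      simp only [Function.comp_apply, e1, e2, h1, false_or]
  rw [L r s e1 e2, L s r e3 e4]
  simp only [or_comm (a := Cmp (t (QH.fa s)) (t (QH.fb s)))]
  congr 2
  have comm : Equiv.Perm.Disjoint (sg r) (sg s) := by
    rw [Equiv.Perm.disjoint_iff_eq_or_eq]
    intro x
    by_cases hx : x = QH.fa r ∨ x = QH.fb r
    · right; rcases hx with rfl | rfl <;> assumption
    · push Not at hx
      left; exact Equiv.swap_apply_of_ne_of_ne hx.1 hx.2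
  funext k
  have := congrArg (fun p : Equiv.Perm (Fin n) => p k) comm.commute.eq
  simp only [Equiv.Perm.mul_apply] at this
  simp only [Function.comp_apply, this]

theorem P_sq_zero {t : Fin n → Fin l × ℕ × ℕ} (h : IsStdM l n lam t) (r : Fin (n - 1))
    (hc : Cmp (t (QH.fa r)) (t (QH.fb r))) :
    (Pmap F ℓ l n lam r ^ 2) (vv F lam t) = 0 := by
  rw [pow_two, Module.End.mul_apply, P_vv h, if_pos hc, map_zero]

theorem P_sq_one {t : Fin n → Fin l × ℕ × ℕ} (h : IsStdM l n lam t) (r : Fin (n - 1))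
    (hc : ¬ Cmp (t (QH.fa r)) (t (QH.fb r))) :
    (Pmap F ℓ l n lam r ^ 2) (vv F lam t) = vv F lam t := by
  have hs := (std_swap h r).2 hc
  rw [pow_two, Module.End.mul_apply, P_vv h, if_neg hc, P_vv hs]
  have hc' : ¬ Cmp ((t ∘ sg r) (QH.fa r)) ((t ∘ sg r) (QH.fb r)) := by
    simp only [Function.comp_apply, sg, Equiv.swap_apply_left, Equiv.swap_apply_right]
    exact not_cmp_succ h _ _ (Fin.lt_def.mpr (by simp [QH.fa, QH.fb]))
  rw [if_neg hc']
  congr 1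
  funext k
  simp [sg]

/-- Images of the generators. -/
noncomputable def gens (F : Type) [Field F] (ℓ l n : ℕ) (κ : Fin l → ℤ)
    (lam : Fin l → YoungDiagram) : QGen ℓ n → Module.End F (SpechtV F l n lam)
  | QGen.e i => Emap F ℓ l n κ lam i
  | QGen.x _ => 0
  | QGen.p r => Pmap F ℓ l n lam r

/-- The map from the free algebra. -/
noncomputable def rho0 (F : Type) [Field F] (ℓ l n : ℕ) (κ : Fin l → ℤ)
    (lam : Fin l → YoungDiagram) : QFree F ℓ n →ₐ[F] Module.End F (SpechtV F l n lam) :=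
  FreeAlgebra.lift F (gens F ℓ l n κ lam)

theorem rho0_E (i : Fin n → Fin (ℓ + 1)) :
    rho0 F ℓ l n κ lam (QH.E F i) = Emap F ℓ l n κ lam i := by
  simp [rho0, QH.E, gens]

theorem rho0_X (r : Fin n) : rho0 F ℓ l n κ lam (QH.X F r) = 0 := by
  simp [rho0, QH.X, gens]

theorem rho0_P (r : Fin (n - 1)) :
    rho0 F ℓ l n κ lam (QH.P F r) = Pmap F ℓ l n lam r := by
  simp [rho0, QH.P, gens]

theorem rho0_rel (hℓ : 2 ≤ ℓ) (hn : 2 ≤ n) (h1 : SS1F ℓ l n κ) (h2 : SS2F ℓ l n κ)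
    (hlam : IsMPT l n lam) ⦃a b : QFree F ℓ n⦄ (hab : QH.Rel F ℓ n l κ a b) :
    rho0 F ℓ l n κ lam a = rho0 F ℓ l n κ lam b := by
  have rc : ∀ t, IsStdM l n lam t → ∀ i : Fin n → Fin (ℓ + 1), resSeqF ℓ n κ t = i →
      ∀ r : Fin (n - 1),
      (Cmp (t (QH.fa r)) (t (QH.fb r)) ∧
        ((i (QH.fb r)).val = (i (QH.fa r)).val + 1 ∨
          (i (QH.fa r)).val = (i (QH.fb r)).val + 1)) ∨
      (¬ Cmp (t (QH.fa r)) (t (QH.fb r)) ∧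
        ((i (QH.fa r)).val + 2 ≤ (i (QH.fb r)).val ∨
          (i (QH.fb r)).val + 2 ≤ (i (QH.fa r)).val)) := by
    rintro t ht i rfl r
    exact res_cases hℓ hn h1 h2 hlam ht (QH.fa r) (QH.fb r) rfl
  cases hab with
  | idem i j =>
    apply end_ext
    intro t ht
    by_cases hij : i = j
    · subst hij
      rw [if_pos rfl, map_mul, rho0_E, Module.End.mul_apply, E_vv ht]
      split_ifs with h
      · rw [E_vv ht, if_pos h]
      · simp
    · rw [if_neg hij, map_mul, rho0_E, rho0_E, Module.End.mul_apply, E_vv ht]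
      split_ifs with h
      · rw [E_vv ht, if_neg (by rw [h]; exact Ne.symm hij)]; simp
      · simp
  | sum =>
    apply end_ext
    intro t ht
    simp only [map_sum, rho0_E, map_one, LinearMap.sum_apply, E_vv ht, Module.End.one_apply]
    simp
  | xe r i => simp [rho0_X]
  | xx r s => simp [rho0_X]
  | pe r i =>
    simp only [map_mul, rho0_E, rho0_P]
    apply end_ext
    intro t ht
    rw [Module.End.mul_apply, Module.End.mul_apply, E_vv ht, P_vv ht]
    by_cases hc : Cmp (t (QH.fa r)) (t (QH.fb r))
    · rw [if_pos hc, map_zero]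
      split_ifs
      · rw [P_vv ht, if_pos hc]
      · simp
    · have hs := (std_swap ht r).2 hc
      rw [if_neg hc, E_vv hs]
      have : resSeqF ℓ n κ (t ∘ sg r) = resSeqF ℓ n κ t ∘ sg r := rfl
      by_cases hi : resSeqF ℓ n κ t = i
      · rw [if_pos hi, P_vv ht, if_neg hc, if_pos]
        rw [this, hi]; rfl
      · rw [if_neg hi, if_neg, map_zero]
        intro e
        rw [this] at e
        apply hi
        exact (sg r).surjective.injective_comp_right e
  | px r s _ _ => simp [rho0_X]
  | xape r i =>
    simp only [map_mul, map_sub, rho0_X, rho0_E, rho0_P]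
    apply mulE_ext
    intro t ht hi
    have := rc t ht i hi r
    have hne : i (QH.fa r) ≠ i (QH.fb r) := fun e => by rw [e] at this; omega
    rw [if_neg hne]
    simp
  | xbpe r i =>
    simp only [map_mul, map_add, rho0_X, rho0_E, rho0_P]
    apply mulE_ext
    intro t ht hi
    have := rc t ht i hi r
    have hne : i (QH.fa r) ≠ i (QH.fb r) := fun e => by rw [e] at this; omega
    rw [if_neg hne]
    simp
  | ppfar r s h =>
    simp only [map_mul, rho0_P]
    apply end_ext
    intro t ht
    exact P_far ht r s h
  | quad01 r i h =>
    simp only [map_mul, map_add, map_pow, rho0_X, rho0_E, rho0_P]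
    apply mulE_ext
    intro t ht hi
    rcases rc t ht i hi r with hc | hc
    · rw [P_sq_zero ht r hc.1]; simp
    · omega
  | quad10 r i h =>
    simp only [map_mul, map_add, map_pow, rho0_X, rho0_E, rho0_P]
    apply mulE_ext
    intro t ht hi
    rcases rc t ht i hi r with hc | hc
    · rw [P_sq_zero ht r hc.1]; simp
    · omega
  | quadAdj r i h _ _ _ _ =>
    simp only [map_mul, map_add, map_pow, rho0_X, rho0_E, rho0_P]
    apply mulE_ext
    intro t ht hi
    rcases rc t ht i hi r with hc | hc
    · rw [P_sq_zero ht r hc.1]; simp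
    · omega
  | quadEq r i h =>
    simp only [map_mul, map_pow, map_zero, rho0_E, rho0_P]
    rw [← zero_mul (Emap F ℓ l n κ lam i)]
    apply mulE_ext
    intro t ht hi
    have := rc t ht i hi r
    rw [h] at this
    omega
  | quadFar r i hne e1 e2 =>
    simp only [map_mul, map_pow, rho0_E, rho0_P]
    conv_rhs => rw [← one_mul (Emap F ℓ l n κ lam i)]
    apply mulE_ext
    intro t ht hi
    rcases rc t ht i hi r with hc | hc
    · omega
    · rw [P_sq_one ht r hc.1]; simp
  | braidSpec r h i heq hres =>
    simp only [map_mul, map_add, rho0_X, rho0_E, rho0_P, add_zero]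
    apply mulE_ext
    intro t ht hi
    exact P_braid ht r ⟨r.val + 1, h⟩ rfl
  | braidAdj r h i heq hadj hb0 hbl =>
    simp only [map_mul, map_add, map_one, rho0_E, rho0_P]
    apply mulE_ext
    intro t ht hi
    exfalso
    have c1 := rc t ht i hi r
    have c2 := rc t ht i hi ⟨r.val + 1, h⟩
    have ea : QH.fa (⟨r.val + 1, h⟩ : Fin (n - 1)) = QH.fb r := rfl
    have eb : QH.fb (⟨r.val + 1, h⟩ : Fin (n - 1)) = ⟨r.val + 2, by omega⟩ := rfl
    rw [ea, eb] at c2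
    have d1 : Cmp (t (QH.fa r)) (t (QH.fb r)) := by
      rcases c1 with c1 | c1
      · exact c1.1
      · omega
    have d2 : Cmp (t (QH.fb r)) (t ⟨r.val + 2, by omega⟩) := by
      rcases c2 with c2 | c2
      · exact c2.1
      · omega
    subst hi
    have := res_three (κ := κ) hℓ ht (QH.fa r) (QH.fb r) ⟨r.val + 2, by omega⟩ rfl rfl d1 d2 heq
    exact this.elim hb0 hbl
  | braidFar r h i hno =>
    simp only [map_mul, rho0_E, rho0_P]
    apply mulE_ext
    intro t ht hi
    exact P_braid ht r ⟨r.val + 1, h⟩ rfl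
  | cyc hn0 i =>
    simp only [map_mul, map_pow, map_zero, rho0_E, rho0_X]
    conv_rhs => rw [← zero_mul (Emap F ℓ l n κ lam i)]
    apply mulE_ext
    intro t ht hi
    have hpos : QH.wtMultF ℓ κ (i ⟨0, hn0⟩) ≠ 0 := by
      unfold QH.wtMultF
      rw [Finset.card_ne_zero]
      have h00 : ((0, 0) : ℕ × ℕ) ∈ lam (t ⟨0, hn0⟩).1 :=
        (lam _).isLowerSet (by simp [Prod.le_def]) (std_mem ht ⟨0, hn0⟩)
      obtain ⟨k, hk⟩ := (ht.2.1 _ _).1 h00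
      have hle : k ≤ ⟨0, hn0⟩ := (std_iff.1 ht).2.2 _ _ (by
        rw [hk]; exact ⟨rfl, by simp [Prod.le_def]⟩)
      have hk0 : k = ⟨0, hn0⟩ := Fin.ext (by rw [Fin.le_def] at hle; simpa using hle)
      rw [hk0] at hk
      refine ⟨(t ⟨0, hn0⟩).1, ?_⟩
      rw [Finset.mem_filter]
      refine ⟨Finset.mem_univ _, ?_⟩
      rw [← hi, resSeqF]
      rw [show (t ⟨0, hn0⟩).2 = (0, 0) from congrArg Prod.snd hk]
      simp
    rw [zero_pow hpos]

end action

end SpechtAux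

/-- Theorem 3.4: under (SS1) and (SS2), for each `l`-multipartition `λ` of `n` the
prescribed action on the span of `{v^t : t ∈ Std(λ)}` (with `e(i) v^t = δ_{i,i^t} v^t`,
`x_r v^t = 0`, `ψ_r v^t = v^{s_r t}`) satisfies all defining relations of `R^Λ_n`
(i.e., extends to an algebra homomorphism `R^Λ_n → End(V)`), and the resulting module is
irreducible. -/
theorem specht_module_irreducible (ℓ n l : ℕ) (hℓ : 2 ≤ ℓ) (hn : 2 ≤ n)
    (κ : Fin l → ℤ) (h1 : SS1F ℓ l n κ) (h2 : SS2F ℓ l n κ)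
    (lam : Fin l → YoungDiagram) (hlam : IsMPT l n lam) :
    ∃ ρ : RC F ℓ n l κ →ₐ[F] Module.End F (SpechtV F l n lam),
      (∀ i : Fin n → Fin (ℓ + 1), ρ (QH.gE F ℓ n l κ i) = Emap F ℓ l n κ lam i) ∧
      (∀ r : Fin n, ρ (QH.gX F ℓ n l κ r) = 0) ∧
      (∀ r : Fin (n - 1), ρ (QH.gP F ℓ n l κ r) = Pmap F ℓ l n lam r) ∧
      (⊥ : Submodule F (SpechtV F l n lam)) ≠ ⊤ ∧
      (∀ W : Submodule F (SpechtV F l n lam),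
        (∀ (a : RC F ℓ n l κ) (w : SpechtV F l n lam), w ∈ W → ρ a w ∈ W) →
        W = ⊥ ∨ W = ⊤) := by
  refine ⟨RingQuot.liftAlgHom F ⟨SpechtAux.rho0 F ℓ l n κ lam,
    SpechtAux.rho0_rel hℓ hn h1 h2 hlam⟩, ?_, ?_, ?_, ?_, ?_⟩
  · intro i
    rw [QH.gE, RingQuot.liftAlgHom_mkAlgHom_apply, SpechtAux.rho0_E]
  · intro r
    rw [QH.gX, RingQuot.liftAlgHom_mkAlgHom_apply, SpechtAux.rho0_X]
  · intro r
    rw [QH.gP, RingQuot.liftAlgHom_mkAlgHom_apply, SpechtAux.rho0_P]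
  · obtain ⟨T, hT⟩ := SpechtAux.exists_std lam hlam
    haveI : Nonempty (STab l n lam) := ⟨⟨T, hT⟩⟩
    exact bot_ne_top
  · intro W hW
    have hE : ∀ i w, w ∈ W → Emap F ℓ l n κ lam i w ∈ W := by
      intro i w hw
      have := hW (QH.gE F ℓ n l κ i) w hw
      rwa [QH.gE, RingQuot.liftAlgHom_mkAlgHom_apply, SpechtAux.rho0_E] at this
    have hP : ∀ r w, w ∈ W → Pmap F ℓ l n lam r w ∈ W := by
      intro r w hw
      have := hW (QH.gP F ℓ n l κ r) w hw
      rwa [QH.gP, RingQuot.liftAlgHom_mkAlgHom_apply, SpechtAux.rho0_P] at this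
    by_cases hbot : W = ⊥
    · exact Or.inl hbot
    right
    obtain ⟨w, hw, hw0⟩ := (Submodule.ne_bot_iff W).1 hbot
    obtain ⟨T, hT⟩ := Finsupp.ne_iff.1 hw0
    have hsingle : Emap F ℓ l n κ lam (resSeqF ℓ n κ T.val) w = Finsupp.single T (w T) := by
      rw [Emap, Finsupp.lsum_apply, Finsupp.sum, Finset.sum_eq_single T]
      · rw [if_pos rfl]; rfl
      · intro S _ hne
        rw [if_neg]
        · rfl
        · intro he
          apply hne
          apply Subtype.ext
          exact SpechtAux.res_inj hℓ hn h1 h2 hlam S.2 T.2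
            (fun k => congrArg Fin.val (congrFun he k))
      · intro hS
        rw [Finsupp.notMem_support_iff.1 hS]
        simp
    have hTW : SpechtAux.vv F lam T.val ∈ W := by
      have := W.smul_mem (w T)⁻¹ (hE (resSeqF ℓ n κ T.val) w hw)
      rw [hsingle, Finsupp.smul_single, smul_eq_mul, inv_mul_cancel₀ hT] at this
      rw [SpechtAux.vv_std T.2]
      exact this
    have hall : ∀ S : STab l n lam, SpechtAux.vv F lam S.val ∈ W := by
      intro S
      refine SpechtAux.connected' (by omega) (fun t => SpechtAux.vv F lam t ∈ W) ?_ T.2 S.2 hTW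
      intro S r hS hS' hmem
      have := hP r _ hmem
      rwa [SpechtAux.P_vv hS, if_neg ((SpechtAux.std_swap hS r).1 hS')] at this
    rw [eq_top_iff]
    intro v _
    induction v using Finsupp.induction_linear with
    | zero => exact W.zero_mem
    | add f g hf hg => exact W.add_mem (hf trivial) (hg trivial)
    | single S c =>
      have := W.smul_mem c (hall S)
      rw [SpechtAux.vv_std S.2, Finsupp.smul_single, smul_eq_mul, mul_one] at this
      exact this
end

section
/- Let F be a field and suppose (SS1) and (SS2) hold. Then x_1 = x_2 = … = x_n = 0 in the cyclotomic quiver Hecke algebra R^Λ_n of type C; more precisely, for every i in the set I^n_Λ of residue sequences of standard tableaux, x_r e(i) = 0 for all 1 ≤ r ≤ n, and e(i) = 0 for i ∉ I^n_Λ. -/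
variable (F : Type) [Field F]

namespace QHP
open QH

section Algebra
variable {F} {ℓ n l : ℕ} {κ : Fin l → ℤ}

/-- `e(i)` for a sequence indexed by `ℕ`. -/
noncomputable def eN (F : Type) [Field F] (ℓ n l : ℕ) (κ : Fin l → ℤ) (i : ℕ → Fin (ℓ + 1)) :
    RC F ℓ n l κ := gE F ℓ n l κ (fun k => i k.val)

noncomputable def xN (F : Type) [Field F] (ℓ n l : ℕ) (κ : Fin l → ℤ) (r : ℕ) : RC F ℓ n l κ :=
  if h : r < n then gX F ℓ n l κ ⟨r, h⟩ else 0

noncomputable def pN (F : Type) [Field F] (ℓ n l : ℕ) (κ : Fin l → ℤ) (r : ℕ) : RC F ℓ n l κ :=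
  if h : r < n - 1 then gP F ℓ n l κ ⟨r, h⟩ else 0

def swN {ℓ : ℕ} (r : ℕ) (i : ℕ → Fin (ℓ + 1)) : ℕ → Fin (ℓ + 1) :=
  fun u => if u = r then i (r + 1) else if u = r + 1 then i r else i u

theorem swN_l {ℓ : ℕ} (r : ℕ) (i : ℕ → Fin (ℓ + 1)) : swN r i r = i (r + 1) := by simp [swN]
theorem swN_r {ℓ : ℕ} (r : ℕ) (i : ℕ → Fin (ℓ + 1)) : swN r i (r + 1) = i r := by simp [swN]
theorem swN_o {ℓ : ℕ} (r u : ℕ) (i : ℕ → Fin (ℓ + 1)) (h : u ≠ r) (h' : u ≠ r + 1) :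
    swN r i u = i u := by simp [swN, h, h']

theorem mk_rel {a b : QFree F ℓ n} (h : Rel F ℓ n l κ a b) :
    RingQuot.mkAlgHom F (Rel F ℓ n l κ) a = RingQuot.mkAlgHom F (Rel F ℓ n l κ) b :=
  RingQuot.mkAlgHom_rel F h

theorem xN_eq {r : ℕ} (h : r < n) :
    xN F ℓ n l κ r = RingQuot.mkAlgHom F (Rel F ℓ n l κ) (X F ⟨r, h⟩) := by
  simp [xN, h, gX]
theorem pN_eq {r : ℕ} (h : r < n - 1) :
    pN F ℓ n l κ r = RingQuot.mkAlgHom F (Rel F ℓ n l κ) (P F ⟨r, h⟩) := by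
  simp [pN, h, gP]
theorem eN_eq (i : ℕ → Fin (ℓ + 1)) :
    eN F ℓ n l κ i = RingQuot.mkAlgHom F (Rel F ℓ n l κ) (E F (fun k : Fin n => i k.val)) := rfl

theorem sw_eq (i : ℕ → Fin (ℓ + 1)) (r : ℕ) (h : r < n - 1) :
    sw ⟨r, h⟩ (fun k : Fin n => i k.val) = fun k : Fin n => swN r i k.val := by
  funext k
  simp only [sw, Function.comp, swN, fa, fb, Equiv.swap_apply_def, Fin.ext_iff]
  split_ifs <;> rfl

theorem R_idem (i : ℕ → Fin (ℓ + 1)) :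
    eN F ℓ n l κ i * eN F ℓ n l κ i = eN F ℓ n l κ i := by
  have := mk_rel (Rel.idem (F := F) (l := l) (κ := κ) (fun k : Fin n => i k.val) (fun k => i k.val))
  simpa [eN_eq] using this

theorem R_xe (i : ℕ → Fin (ℓ + 1)) (r : ℕ) :
    xN F ℓ n l κ r * eN F ℓ n l κ i = eN F ℓ n l κ i * xN F ℓ n l κ r := by
  by_cases h : r < n
  · have := mk_rel (Rel.xe (F := F) (l := l) (κ := κ) ⟨r, h⟩ (fun k : Fin n => i k.val))
    simpa [eN_eq, xN_eq h] using this
  · simp [xN, h]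

theorem R_pe (i : ℕ → Fin (ℓ + 1)) (r : ℕ) :
    pN F ℓ n l κ r * eN F ℓ n l κ i = eN F ℓ n l κ (swN r i) * pN F ℓ n l κ r := by
  by_cases h : r < n - 1
  · have := mk_rel (Rel.pe (F := F) (l := l) (κ := κ) ⟨r, h⟩ (fun k : Fin n => i k.val))
    rw [sw_eq] at this
    simpa [eN_eq, pN_eq h] using this
  · simp [pN, h]

theorem R_px (r s : ℕ) (h1 : s ≠ r) (h2 : s ≠ r + 1) :
    pN F ℓ n l κ r * xN F ℓ n l κ s = xN F ℓ n l κ s * pN F ℓ n l κ r := by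
  by_cases h : r < n - 1
  · by_cases h' : s < n
    · have := mk_rel (Rel.px (F := F) (ℓ := ℓ) (l := l) (κ := κ) ⟨r, h⟩ ⟨s, h'⟩
        (by simpa [fa, Fin.ext_iff] using h1) (by simpa [fb, Fin.ext_iff] using h2))
      simpa [xN_eq h', pN_eq h] using this
    · simp [xN, h']
  · simp [pN, h]

theorem R_xa (i : ℕ → Fin (ℓ + 1)) (r : ℕ) (h : r + 1 < n) :
    xN F ℓ n l κ r * pN F ℓ n l κ r * eN F ℓ n l κ i =
      (pN F ℓ n l κ r * xN F ℓ n l κ (r + 1) - if i r = i (r + 1) then 1 else 0) *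
        eN F ℓ n l κ i := by
  have := mk_rel (Rel.xape (F := F) (l := l) (κ := κ) ⟨r, by omega⟩ (fun k : Fin n => i k.val))
  rw [xN_eq h, xN_eq (show r < n by omega), pN_eq (show r < n - 1 by omega), eN_eq]
  by_cases hi : i r = i (r + 1)
  · simpa [hi, fa, fb] using this
  · simpa [hi, fa, fb] using this

theorem R_xb (i : ℕ → Fin (ℓ + 1)) (r : ℕ) (h : r + 1 < n) :
    xN F ℓ n l κ (r + 1) * pN F ℓ n l κ r * eN F ℓ n l κ i =
      (pN F ℓ n l κ r * xN F ℓ n l κ r + if i r = i (r + 1) then 1 else 0) *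
        eN F ℓ n l κ i := by
  have := mk_rel (Rel.xbpe (F := F) (l := l) (κ := κ) ⟨r, by omega⟩ (fun k : Fin n => i k.val))
  rw [xN_eq h, xN_eq (show r < n by omega), pN_eq (show r < n - 1 by omega), eN_eq]
  by_cases hi : i r = i (r + 1)
  · simpa [hi, fa, fb] using this
  · simpa [hi, fa, fb] using this

theorem R_q10 (i : ℕ → Fin (ℓ + 1)) (r : ℕ) (h : r + 1 < n)
    (hh : ((i r).val = 1 ∧ (i (r + 1)).val = 0) ∨
      ((i r).val = ℓ - 1 ∧ (i (r + 1)).val = ℓ)) :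
    pN F ℓ n l κ r ^ 2 * eN F ℓ n l κ i =
      (xN F ℓ n l κ r ^ 2 + xN F ℓ n l κ (r + 1)) * eN F ℓ n l κ i := by
  have := mk_rel (Rel.quad10 (F := F) (l := l) (κ := κ) ⟨r, by omega⟩ (fun k : Fin n => i k.val) hh)
  rw [xN_eq h, xN_eq (show r < n by omega), pN_eq (show r < n - 1 by omega), eN_eq]
  simpa [fa, fb] using this

theorem R_qAdj (i : ℕ → Fin (ℓ + 1)) (r : ℕ) (h : r + 1 < n)
    (hh : (i (r + 1)).val = (i r).val + 1 ∨ (i r).val = (i (r + 1)).val + 1)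
    (ha0 : (i r).val ≠ 0) (hb0 : (i (r + 1)).val ≠ 0)
    (hal : (i r).val ≠ ℓ) (hbl : (i (r + 1)).val ≠ ℓ) :
    pN F ℓ n l κ r ^ 2 * eN F ℓ n l κ i =
      (xN F ℓ n l κ r + xN F ℓ n l κ (r + 1)) * eN F ℓ n l κ i := by
  have := mk_rel (Rel.quadAdj (F := F) (l := l) (κ := κ) ⟨r, by omega⟩ (fun k : Fin n => i k.val)
    hh ha0 hb0 hal hbl)
  rw [xN_eq h, xN_eq (show r < n by omega), pN_eq (show r < n - 1 by omega), eN_eq]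
  simpa [fa, fb] using this

theorem R_qEq (i : ℕ → Fin (ℓ + 1)) (r : ℕ) (h : r + 1 < n) (hh : i r = i (r + 1)) :
    pN F ℓ n l κ r ^ 2 * eN F ℓ n l κ i = 0 := by
  have := mk_rel (Rel.quadEq (F := F) (l := l) (κ := κ) ⟨r, by omega⟩ (fun k : Fin n => i k.val) hh)
  rw [pN_eq (show r < n - 1 by omega), eN_eq]
  simpa using this

/-- Two residues are far: distinct and non-adjacent. -/
def Far {ℓ : ℕ} (a b : Fin (ℓ + 1)) : Prop :=
  a.val ≠ b.val ∧ b.val ≠ a.val + 1 ∧ a.val ≠ b.val + 1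

theorem Far.symm {ℓ : ℕ} {a b : Fin (ℓ + 1)} (h : Far a b) : Far b a :=
  ⟨h.1.symm, h.2.2, h.2.1⟩

theorem R_qFar (i : ℕ → Fin (ℓ + 1)) (r : ℕ) (h : r + 1 < n) (hh : Far (i r) (i (r + 1))) :
    pN F ℓ n l κ r ^ 2 * eN F ℓ n l κ i = eN F ℓ n l κ i := by
  have := mk_rel (Rel.quadFar (F := F) (l := l) (κ := κ) ⟨r, by omega⟩ (fun k : Fin n => i k.val)
    (fun h => hh.1 (congrArg Fin.val h)) hh.2.1 hh.2.2)
  rw [pN_eq (show r < n - 1 by omega), eN_eq]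
  simpa using this

theorem R_bSpec (i : ℕ → Fin (ℓ + 1)) (r : ℕ) (h : r + 2 < n) (heq : i r = i (r + 2))
    (hres : ((i r).val = 1 ∧ (i (r + 1)).val = 0) ∨
      ((i r).val = ℓ - 1 ∧ (i (r + 1)).val = ℓ)) :
    pN F ℓ n l κ (r + 1) * pN F ℓ n l κ r * pN F ℓ n l κ (r + 1) * eN F ℓ n l κ i =
      (pN F ℓ n l κ r * pN F ℓ n l κ (r + 1) * pN F ℓ n l κ r + xN F ℓ n l κ r
        + xN F ℓ n l κ (r + 2)) * eN F ℓ n l κ i := by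
  have := mk_rel (Rel.braidSpec (F := F) (l := l) (κ := κ) ⟨r, by omega⟩
    (show r + 1 < n - 1 by omega) (fun k : Fin n => i k.val) (congrArg Fin.val heq) hres)
  rw [xN_eq h, xN_eq (show r < n by omega), pN_eq (show r < n - 1 by omega),
    pN_eq (show r + 1 < n - 1 by omega), eN_eq]
  simpa [fa, fb] using this

theorem R_bAdj (i : ℕ → Fin (ℓ + 1)) (r : ℕ) (h : r + 2 < n) (heq : i r = i (r + 2))
    (hadj : (i r).val = (i (r + 1)).val + 1 ∨ (i (r + 1)).val = (i r).val + 1)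
    (hb0 : (i (r + 1)).val ≠ 0) (hbl : (i (r + 1)).val ≠ ℓ) :
    pN F ℓ n l κ (r + 1) * pN F ℓ n l κ r * pN F ℓ n l κ (r + 1) * eN F ℓ n l κ i =
      (pN F ℓ n l κ r * pN F ℓ n l κ (r + 1) * pN F ℓ n l κ r + 1) * eN F ℓ n l κ i := by
  have := mk_rel (Rel.braidAdj (F := F) (l := l) (κ := κ) ⟨r, by omega⟩
    (show r + 1 < n - 1 by omega) (fun k : Fin n => i k.val) (congrArg Fin.val heq) hadj hb0 hbl)
  rw [pN_eq (show r < n - 1 by omega),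
    pN_eq (show r + 1 < n - 1 by omega), eN_eq]
  simpa [fa, fb] using this

theorem R_cyc (hn : 0 < n) (i : ℕ → Fin (ℓ + 1)) :
    xN F ℓ n l κ 0 ^ (wtMultF ℓ κ (i 0)) * eN F ℓ n l κ i = 0 := by
  have := mk_rel (Rel.cyc (F := F) (l := l) (κ := κ) hn (fun k : Fin n => i k.val))
  rw [xN_eq hn, eN_eq]
  simpa using this

theorem R_sum : ∑ i : Fin n → Fin (ℓ + 1), gE F ℓ n l κ i = 1 := by
  have := mk_rel (Rel.sum (F := F) (ℓ := ℓ) (n := n) (l := l) (κ := κ))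
  simpa [gE] using this

/-! ### Derived algebraic lemmas -/

theorem p_sq (i : ℕ → Fin (ℓ + 1)) (r : ℕ) :
    pN F ℓ n l κ r ^ 2 * eN F ℓ n l κ i =
      pN F ℓ n l κ r * eN F ℓ n l κ (swN r i) * pN F ℓ n l κ r := by
  rw [pow_two, mul_assoc, R_pe, mul_assoc]

theorem step_e (i : ℕ → Fin (ℓ + 1)) (r : ℕ) (h : r + 1 < n) (hh : Far (i r) (i (r + 1)))
    (h0 : eN F ℓ n l κ (swN r i) = 0) : eN F ℓ n l κ i = 0 := by
  rw [← R_qFar i r h hh, p_sq, h0]; simp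

theorem step_x (i : ℕ → Fin (ℓ + 1)) (r : ℕ) (h : r + 1 < n) (hh : Far (i r) (i (r + 1)))
    (h0 : xN F ℓ n l κ r * eN F ℓ n l κ (swN r i) = 0) :
    xN F ℓ n l κ (r + 1) * eN F ℓ n l κ i = 0 := by
  have hne : ¬ (swN r i r = swN r i (r + 1)) := by
    rw [swN_l, swN_r]; intro h; exact hh.1 (congrArg Fin.val h).symm
  have h3 := R_xb (F := F) (κ := κ) (swN r i) r h
  rw [if_neg hne, add_zero, mul_assoc (pN F ℓ n l κ r), h0, mul_zero] at h3
  rw [← R_qFar i r h hh, p_sq, ← mul_assoc, ← mul_assoc, h3, zero_mul]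

theorem step_xo (i : ℕ → Fin (ℓ + 1)) (r s : ℕ) (h : r + 1 < n) (hh : Far (i r) (i (r + 1)))
    (h1 : s ≠ r) (h2 : s ≠ r + 1)
    (h0 : xN F ℓ n l κ s * eN F ℓ n l κ (swN r i) = 0) :
    xN F ℓ n l κ s * eN F ℓ n l κ i = 0 := by
  rw [← R_qFar i r h hh, p_sq, ← mul_assoc, ← mul_assoc, ← R_px r s h1 h2, mul_assoc (pN F ℓ n l κ r),
    h0]
  simp

theorem down (p d : ℕ) : ∀ (i : ℕ → Fin (ℓ + 1)), p + d < n →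
    (∀ u, p ≤ u → u < p + d → Far (i u) (i (p + d))) →
    ∃ i' : ℕ → Fin (ℓ + 1), (∀ u < p, i' u = i u) ∧ i' p = i (p + d) ∧
      (eN F ℓ n l κ i' = 0 → eN F ℓ n l κ i = 0) ∧
      (xN F ℓ n l κ p * eN F ℓ n l κ i' = 0 → xN F ℓ n l κ (p + d) * eN F ℓ n l κ i = 0) := by
  induction d with
  | zero => intro i _ _; exact ⟨i, fun _ _ => rfl, rfl, id, id⟩
  | succ d ih =>
    intro i hn hf
    have hl := swN_l (p + d) i
    have hfar : Far (i (p + d)) (i (p + d + 1)) := hf (p + d) (by omega) (by omega)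
    obtain ⟨i', a1, a2, a3, a4⟩ := ih (swN (p + d) i) (by omega) (by
      intro u h1 h2
      rw [hl, swN_o _ _ _ (by omega) (by omega)]
      exact hf u h1 (by omega))
    refine ⟨i', ?_, ?_, ?_, ?_⟩
    · intro u hu; rw [a1 u hu, swN_o _ _ _ (by omega) (by omega)]
    · rw [a2, hl]; rfl
    · intro h; exact step_e i (p + d) (by omega) hfar (a3 h)
    · intro h; exact step_x i (p + d) (by omega) hfar (a4 h)

theorem up (d : ℕ) : ∀ (t : ℕ) (i : ℕ → Fin (ℓ + 1)), t + d < n →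
    (∀ u, t < u → u ≤ t + d → Far (i t) (i u)) →
    ∃ i' : ℕ → Fin (ℓ + 1), (∀ u > t + d, i' u = i u) ∧ i' (t + d) = i t ∧
      (eN F ℓ n l κ i' = 0 → eN F ℓ n l κ i = 0) ∧
      (∀ s > t + d, xN F ℓ n l κ s * eN F ℓ n l κ i' = 0 →
        xN F ℓ n l κ s * eN F ℓ n l κ i = 0) := by
  induction d with
  | zero => intro t i _ _; exact ⟨i, fun _ _ => rfl, rfl, id, fun _ _ => id⟩
  | succ d ih =>
    intro t i hn hf
    have hl := swN_r t i
    have hfar : Far (i t) (i (t + 1)) := hf (t + 1) (by omega) (by omega)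
    obtain ⟨i', a1, a2, a3, a4⟩ := ih (t + 1) (swN t i) (by omega) (by
      intro u h1 h2
      rw [hl, swN_o _ _ _ (by omega) (by omega)]
      exact hf u (by omega) (by omega))
    have hadd : t + 1 + d = t + (d + 1) := by omega
    rw [hadd] at a1 a2 a4
    refine ⟨i', ?_, ?_, ?_, ?_⟩
    · intro u hu; rw [a1 u hu, swN_o _ _ _ (by omega) (by omega)]
    · rw [a2, hl]
    · intro h; exact step_e i t (by omega) hfar (a3 h)
    · intro s hs h; exact step_xo i t s (by omega) hfar (by omega) (by omega) (a4 s hs h)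

theorem kk (i : ℕ → Fin (ℓ + 1)) (r : ℕ) (h : r + 1 < n) (hh : i r = i (r + 1))
    (hx : xN F ℓ n l κ r = 0) : eN F ℓ n l κ i = 0 := by
  have ha := R_xa (F := F) (κ := κ) i r h
  have hb := R_xb (F := F) (κ := κ) i r h
  have hq := R_qEq (F := F) (κ := κ) i r h hh
  rw [hx, if_pos hh] at ha hb
  rw [zero_mul, zero_mul, sub_mul, one_mul, eq_comm, sub_eq_zero] at ha
  rw [mul_zero, zero_add, one_mul] at hb
  have hp : pN F ℓ n l κ r * eN F ℓ n l κ i = 0 := by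
    rw [← ha, mul_assoc (pN F ℓ n l κ r), R_xe, ← mul_assoc, ← mul_assoc, ← pow_two, hq, zero_mul]
  rw [← hb, mul_assoc, hp, mul_zero]

theorem adj_x (i : ℕ → Fin (ℓ + 1)) (r : ℕ) (h : r + 1 < n)
    (hh : (i (r + 1)).val = (i r).val + 1 ∨ (i r).val = (i (r + 1)).val + 1)
    (ha0 : (i r).val ≠ 0) (hal : (i r).val ≠ ℓ)
    (hx : xN F ℓ n l κ r = 0) (he : eN F ℓ n l κ (swN r i) = 0) :
    xN F ℓ n l κ (r + 1) * eN F ℓ n l κ i = 0 := by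
  have hp : pN F ℓ n l κ r ^ 2 * eN F ℓ n l κ i = 0 := by rw [p_sq, he]; simp
  have hlt := (i r).isLt
  have hlt' := (i (r + 1)).isLt
  by_cases hk : (i (r + 1)).val = 0 ∨ (i (r + 1)).val = ℓ
  · have := R_q10 (F := F) (κ := κ) i r h (by omega)
    rw [hp, hx] at this
    simpa using this.symm
  · have := R_qAdj (F := F) (κ := κ) i r h hh ha0 (by omega) hal (by omega)
    rw [hp, hx] at this
    simpa using this.symm

theorem braid_zero (i : ℕ → Fin (ℓ + 1)) (r : ℕ) (h : r + 2 < n) (heq : i r = i (r + 2))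
    (hx : xN F ℓ n l κ r = 0) (hx' : xN F ℓ n l κ (r + 1) = 0) :
    pN F ℓ n l κ r * eN F ℓ n l κ i = 0 ∧ pN F ℓ n l κ (r + 1) * eN F ℓ n l κ i = 0 := by
  constructor
  · rw [R_pe, kk (swN r i) (r + 1) (by omega) _ hx', zero_mul]
    rw [swN_r, swN_o _ _ _ (by omega) (by omega)]; exact heq
  · rw [R_pe, kk (swN (r + 1) i) r (by omega) _ hx, zero_mul]
    rw [swN_l, swN_o _ _ _ (by omega) (by omega)]; exact heq

theorem sand_e (i : ℕ → Fin (ℓ + 1)) (r : ℕ) (h : r + 2 < n) (heq : i r = i (r + 2))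
    (hx : xN F ℓ n l κ r = 0) (hx' : xN F ℓ n l κ (r + 1) = 0)
    (hadj : (i r).val = (i (r + 1)).val + 1 ∨ (i (r + 1)).val = (i r).val + 1)
    (hb0 : (i (r + 1)).val ≠ 0) (hbl : (i (r + 1)).val ≠ ℓ) : eN F ℓ n l κ i = 0 := by
  obtain ⟨z1, z2⟩ := braid_zero i r h heq hx hx'
  have := R_bAdj (F := F) (κ := κ) i r h heq hadj hb0 hbl
  rw [mul_assoc, z2, mul_zero, add_mul, mul_assoc, z1, mul_zero, zero_add, one_mul] at this
  exact this.symm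

theorem sand_x (i : ℕ → Fin (ℓ + 1)) (r : ℕ) (h : r + 2 < n) (heq : i r = i (r + 2))
    (hx : xN F ℓ n l κ r = 0) (hx' : xN F ℓ n l κ (r + 1) = 0)
    (hres : ((i r).val = 1 ∧ (i (r + 1)).val = 0) ∨
      ((i r).val = ℓ - 1 ∧ (i (r + 1)).val = ℓ)) :
    xN F ℓ n l κ (r + 2) * eN F ℓ n l κ i = 0 := by
  obtain ⟨z1, z2⟩ := braid_zero i r h heq hx hx'
  have := R_bSpec (F := F) (κ := κ) i r h heq hres
  rw [mul_assoc, z2, mul_zero, add_mul, add_mul, mul_assoc, z1, mul_zero, zero_add, hx, zero_mul,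
    zero_add] at this
  exact this.symm

end Algebra

section Comb
variable {ℓ n l : ℕ} {κ : Fin l → ℤ}

/-- `b` is the folded value of `w ∈ [-ℓ, 2ℓ]`. -/
def Bv (ℓ : ℕ) (b w : ℤ) : Prop :=
  (w < 0 ∧ b = -w) ∨ (0 ≤ w ∧ w ≤ ℓ ∧ b = w) ∨ (ℓ < w ∧ b = 2 * ℓ - w)

theorem bar_emod (hℓ : 2 ≤ ℓ) (z : ℤ) :
    ((barF ℓ z).val : ℤ) = min (z % (2 * ℓ)) (2 * ℓ - z % (2 * ℓ)) := by
  have h1 := Int.emod_nonneg z (show (2 * ℓ : ℤ) ≠ 0 by omega)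
  have h2 := Int.emod_lt_of_pos z (show (0 : ℤ) < 2 * ℓ by omega)
  simp only [barF]
  generalize z % (2 * ℓ : ℤ) = w at *
  rw [Nat.mod_eq_of_lt (by omega)]
  omega

theorem bar_eq (hℓ : 2 ≤ ℓ) (z q w : ℤ) (h : z = 2 * ℓ * q + w) (h1 : -(ℓ : ℤ) ≤ w)
    (h2 : w ≤ 2 * ℓ) : Bv ℓ (barF ℓ z).val w := by
  have hz : z % (2 * ℓ) = w % (2 * ℓ) := by rw [h]; simp
  rw [bar_emod hℓ, hz]
  unfold Bv
  by_cases hw : w < 0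
  · have : w % (2 * ℓ : ℤ) = w + 2 * ℓ := by
      rw [← Int.add_emod_right, Int.emod_eq_of_lt (by omega) (by omega)]
    rw [this]; omega
  · by_cases hw2 : w = 2 * ℓ
    · rw [hw2]; simp; omega
    · rw [Int.emod_eq_of_lt (by omega) (by omega)]; omega

theorem bar_rep (hℓ : 2 ≤ ℓ) (z : ℤ) : ∃ q w : ℤ, z = 2 * ℓ * q + w ∧ 0 ≤ w ∧ w < 2 * ℓ :=
  ⟨z / (2 * ℓ), z % (2 * ℓ), (Int.mul_ediv_add_emod z _).symm,
    Int.emod_nonneg z (by omega), Int.emod_lt_of_pos z (by omega)⟩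

theorem bar_shift (hℓ : 2 ≤ ℓ) (k : ℤ) : ∃ σ : ℤ, (σ = 1 ∨ σ = -1) ∧
    ∀ d : ℤ, -(ℓ : ℤ) ≤ (barF ℓ k).val + σ * d → (barF ℓ k).val + σ * d ≤ 2 * ℓ →
      Bv ℓ (barF ℓ (k + d)).val ((barF ℓ k).val + σ * d) := by
  obtain ⟨q, w, hz, h1, h2⟩ := bar_rep hℓ k
  have hb := bar_eq hℓ k q w hz (by omega) (by omega)
  by_cases hw : w ≤ ℓ
  · refine ⟨1, Or.inl rfl, fun d hd1 hd2 => ?_⟩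
    have : ((barF ℓ k).val : ℤ) = w := by unfold Bv at hb; omega
    rw [this] at hd1 hd2 ⊢
    exact bar_eq hℓ (k + d) q _ (by rw [hz]; ring) hd1 hd2
  · refine ⟨-1, Or.inr rfl, fun d hd1 hd2 => ?_⟩
    have : ((barF ℓ k).val : ℤ) = 2 * ℓ - w := by unfold Bv at hb; omega
    rw [this] at hd1 hd2 ⊢
    by_cases hc : 2 * ℓ - w + -1 * d ≤ ℓ
    · have := bar_eq hℓ (k + d) (q + 1) (-(2 * ℓ - w + -1 * d)) (by rw [hz]; ring)
        (by omega) (by omega)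
      unfold Bv at *; omega
    · have := bar_eq hℓ (k + d) q (w + d) (by rw [hz]; ring) (by omega) (by omega)
      unfold Bv at *; omega

theorem bar_le (z : ℤ) : (barF ℓ z).val ≤ ℓ := by have := (barF ℓ z).isLt; omega

theorem bar_adj (hℓ : 2 ≤ ℓ) (z : ℤ) (k : Fin (ℓ + 1))
    (h : k.val = (barF ℓ z).val + 1 ∨ (barF ℓ z).val = k.val + 1) :
    barF ℓ (z + 1) = k ∨ barF ℓ (z - 1) = k := by
  obtain ⟨q, w, hz, h1, h2⟩ := bar_rep hℓ z
  have b0 := bar_eq hℓ z q w hz (by omega) (by omega)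
  have b1 := bar_eq hℓ (z + 1) q (w + 1) (by rw [hz]; ring) (by omega) (by omega)
  have b2 := bar_eq hℓ (z - 1) q (w - 1) (by rw [hz]; ring) (by omega) (by omega)
  have := k.isLt
  simp only [Fin.ext_iff]
  unfold Bv at *
  omega

theorem bar_end (hℓ : 2 ≤ ℓ) (z : ℤ) (h : (barF ℓ z).val = 0 ∨ (barF ℓ z).val = ℓ) :
    barF ℓ (z + 1) = barF ℓ (z - 1) ∧ ¬ Far (barF ℓ (z + 2)) (barF ℓ (z - 1)) ∧
      ¬ Far (barF ℓ (z - 2)) (barF ℓ (z + 1)) := by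
  obtain ⟨q, w, hz, h1, h2⟩ := bar_rep hℓ z
  have b0 := bar_eq hℓ z q w hz (by omega) (by omega)
  have b1 := bar_eq hℓ (z + 1) q (w + 1) (by rw [hz]; ring) (by omega) (by omega)
  have b2 := bar_eq hℓ (z - 1) q (w - 1) (by rw [hz]; ring) (by omega) (by omega)
  have hw : w = 0 ∨ w = ℓ := by unfold Bv at b0; omega
  have b3 := bar_eq hℓ (z + 2) q (w + 2) (by rw [hz]; ring) (by omega) (by omega)
  have b4 := bar_eq hℓ (z - 2) q (w - 2) (by rw [hz]; ring) (by omega) (by omega)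
  simp only [Fin.ext_iff]
  unfold Bv Far at *
  omega

/-- residue of a node -/
def res (ℓ : ℕ) {l : ℕ} (κ : Fin l → ℤ) (y : Fin l × ℕ × ℕ) : Fin (ℓ + 1) :=
  barF ℓ (κ y.1 + (y.2.2 : ℤ) - (y.2.1 : ℤ))

def Mem (T : ℕ → Fin l × ℕ × ℕ) (m : ℕ) (y : Fin l × ℕ × ℕ) : Prop := ∃ k < m, T k = y

/-- the first `m` entries form a standard tableau -/
def Std (T : ℕ → Fin l × ℕ × ℕ) (m : ℕ) : Prop :=
  (∀ a < m, ∀ b < m, T a = T b → a = b) ∧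
  ∀ k < m, ∀ r c, r ≤ (T k).2.1 → c ≤ (T k).2.2 → Mem T (k + 1) ((T k).1, r, c)

def Addable (T : ℕ → Fin l × ℕ × ℕ) (m : ℕ) (j : Fin l) (r c : ℕ) : Prop :=
  ¬ Mem T m (j, r, c) ∧ (∀ r' c', r' ≤ r → c' ≤ c → (r', c') ≠ (r, c) → Mem T m (j, r', c'))

theorem Mem.mono {T : ℕ → Fin l × ℕ × ℕ} {m m' : ℕ} {y : Fin l × ℕ × ℕ} (h : Mem T m y)
    (hm : m ≤ m') : Mem T m' y := by
  obtain ⟨k, hk, e⟩ := h; exact ⟨k, by omega, e⟩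

theorem Std.mono {T : ℕ → Fin l × ℕ × ℕ} {m m' : ℕ} (h : Std T m) (hm : m' ≤ m) : Std T m' :=
  ⟨fun a ha b hb => h.1 a (by omega) b (by omega), fun k hk => h.2 k (by omega)⟩

theorem Std.low {T : ℕ → Fin l × ℕ × ℕ} {m : ℕ} (h : Std T m) {p : ℕ} (hp : p ≤ m)
    {j : Fin l} {r c r' c' : ℕ}
    (hy : Mem T p (j, r, c)) (hr : r' ≤ r) (hc : c' ≤ c) : Mem T p (j, r', c') := by
  obtain ⟨k, hk, e⟩ := hy
  have := h.2 k (by omega) r' c' (by rw [e]; exact hr) (by rw [e]; exact hc)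
  rw [e] at this
  exact this.mono (by omega)

theorem addable_of {T : ℕ → Fin l × ℕ × ℕ} {m : ℕ} (h : Std T m) {j : Fin l} {r c : ℕ}
    (h0 : ¬ Mem T m (j, r, c)) (h1 : r = 0 ∨ Mem T m (j, r - 1, c))
    (h2 : c = 0 ∨ Mem T m (j, r, c - 1)) : Addable T m j r c := by
  refine ⟨h0, fun r' c' hr hc hne => ?_⟩
  by_cases hrr : r' = r
  · have : c' ≠ c := by rintro rfl; exact hne (by rw [hrr])
    rcases h2 with h2 | h2
    · omega
    · exact h.low le_rfl h2 hr (by omega)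
  · rcases h1 with h1 | h1
    · omega
    · exact h.low le_rfl h1 (by omega) hc

theorem mem_update {T : ℕ → Fin l × ℕ × ℕ} {m p : ℕ} (hp : p ≤ m) (z y : Fin l × ℕ × ℕ) :
    Mem (Function.update T m z) p y ↔ Mem T p y := by
  constructor
  · rintro ⟨k, hk, e⟩
    exact ⟨k, hk, by rwa [Function.update_of_ne (by omega)] at e⟩
  · rintro ⟨k, hk, e⟩
    exact ⟨k, hk, by rwa [Function.update_of_ne (by omega)]⟩

theorem Std.extend {T : ℕ → Fin l × ℕ × ℕ} {m : ℕ} (h : Std T m) {j : Fin l} {r c : ℕ}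
    (ha : Addable T m j r c) : Std (Function.update T m (j, r, c)) (m + 1) := by
  constructor
  · intro a hha b hb e
    by_cases h1 : a = m
    · by_cases h2 : b = m
      · omega
      · subst h1
        rw [Function.update_self, Function.update_of_ne h2] at e
        exact absurd ⟨b, by omega, e.symm⟩ ha.1
    · by_cases h2 : b = m
      · subst h2
        rw [Function.update_self, Function.update_of_ne h1] at e
        exact absurd ⟨a, by omega, e⟩ ha.1
      · rw [Function.update_of_ne h2, Function.update_of_ne h1] at e
        exact h.1 a (by omega) b (by omega) e
  · intro k hk r' c' hr hc
    by_cases h1 : k = m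
    · subst h1
      rw [Function.update_self] at *
      by_cases hne : (r', c') = (r, c)
      · refine ⟨k, by omega, ?_⟩
        rw [Function.update_self]
        simp only [Prod.mk.injEq] at hne ⊢
        simp [hne.1, hne.2]
      · exact ((mem_update le_rfl _ _).2 (ha.2 r' c' hr hc hne)).mono (by omega)
    · rw [Function.update_of_ne h1] at *
      exact (mem_update (by omega) _ _).2 (h.2 k (by omega) r' c' hr hc)

theorem Std.card_le {T : ℕ → Fin l × ℕ × ℕ} {m : ℕ} (A : Finset (Fin l × ℕ × ℕ))
    (hA : ∀ y ∈ A, Mem T m y) : A.card ≤ m := by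
  have : A ⊆ (Finset.range m).image T := by
    intro y hy
    obtain ⟨k, hk, e⟩ := hA y hy
    exact Finset.mem_image.2 ⟨k, Finset.mem_range.2 hk, e⟩
  calc A.card ≤ _ := Finset.card_le_card this
    _ ≤ _ := Finset.card_image_le
    _ = m := Finset.card_range m

theorem card_two {T : ℕ → Fin l × ℕ × ℕ} {m : ℕ} (h : Std T m) {j1 j2 : Fin l} {r1 c1 r2 c2 : ℕ}
    (h1 : Mem T m (j1, r1, c1)) (h2 : Mem T m (j2, r2, c2)) (hj : j1 ≠ j2) :
    (r1 + 1) * (c1 + 1) + (r2 + 1) * (c2 + 1) ≤ m := by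
  have := Std.card_le (T := T) (m := m)
    ((({j1} : Finset (Fin l)) ×ˢ (Finset.range (r1 + 1) ×ˢ Finset.range (c1 + 1))) ∪
      (({j2} : Finset (Fin l)) ×ˢ (Finset.range (r2 + 1) ×ˢ Finset.range (c2 + 1)))) (by
    rintro ⟨j, r, c⟩ hy
    simp only [Finset.mem_union, Finset.mem_product, Finset.mem_singleton, Finset.mem_range] at hy
    rcases hy with ⟨rfl, hr, hc⟩ | ⟨rfl, hr, hc⟩
    · exact h.low le_rfl h1 (by omega) (by omega)
    · exact h.low le_rfl h2 (by omega) (by omega))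
  rw [Finset.card_union_of_disjoint] at this
  · simpa using this
  · rw [Finset.disjoint_left]
    rintro ⟨j, r, c⟩ hy hy'
    simp only [Finset.mem_product, Finset.mem_singleton] at hy hy'
    exact hj (hy.1.symm.trans hy'.1)

theorem card_inc {T : ℕ → Fin l × ℕ × ℕ} {m : ℕ} (h : Std T m) {j : Fin l} {r1 c1 r2 c2 : ℕ}
    (h1 : Mem T m (j, r1, c1)) (h2 : Mem T m (j, r2, c2)) (hr : r1 < r2) (hc : c2 < c1) :
    r1 + r2 + c1 + 1 ≤ m ∧ c1 + c2 + r2 + 1 ≤ m := by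
  have := Std.card_le (T := T) (m := m)
    ((({j} : Finset (Fin l)) ×ˢ (Finset.range (r1 + 1) ×ˢ Finset.range (c1 + 1))) ∪
      (({j} : Finset (Fin l)) ×ˢ (Finset.Ico (r1 + 1) (r2 + 1) ×ˢ Finset.range (c2 + 1)))) (by
    rintro ⟨j', r, c⟩ hy
    simp only [Finset.mem_union, Finset.mem_product, Finset.mem_singleton, Finset.mem_range,
      Finset.mem_Ico] at hy
    rcases hy with ⟨rfl, hr, hc⟩ | ⟨rfl, hr, hc⟩
    · exact h.low le_rfl h1 (by omega) (by omega)
    · exact h.low le_rfl h2 (by omega) (by omega))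
  rw [Finset.card_union_of_disjoint] at this
  · simp only [Finset.card_product, Finset.card_singleton, Finset.card_range, Nat.card_Ico,
      one_mul] at this
    obtain ⟨a, rfl⟩ : ∃ a, r2 = r1 + 1 + a := ⟨r2 - (r1 + 1), by omega⟩
    obtain ⟨b, rfl⟩ : ∃ b, c1 = c2 + 1 + b := ⟨c1 - (c2 + 1), by omega⟩
    have e : r1 + 1 + a + 1 - (r1 + 1) = a + 1 := by omega
    rw [e] at this
    have q1 := Nat.zero_le (r1 * c2)
    have q2 := Nat.zero_le (r1 * b)
    have q3 := Nat.zero_le (a * c2)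
    constructor <;> nlinarith
  · rw [Finset.disjoint_left]
    rintro ⟨j, r, c⟩ hy hy'
    simp only [Finset.mem_product, Finset.mem_singleton, Finset.mem_range,
      Finset.mem_Ico] at hy hy'
    omega

theorem card_one {T : ℕ → Fin l × ℕ × ℕ} {m : ℕ} (h : Std T m) {j1 : Fin l} {r1 c1 : ℕ}
    (h1 : Mem T m (j1, r1, c1)) : r1 + c1 + 1 ≤ m := by
  have := Std.card_le (T := T) (m := m)
    ((({j1} : Finset (Fin l)) ×ˢ (Finset.range (r1 + 1) ×ˢ Finset.range (c1 + 1)))) (by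
    rintro ⟨j, r, c⟩ hy
    simp only [Finset.mem_product, Finset.mem_singleton, Finset.mem_range] at hy
    obtain ⟨rfl, hr, hc⟩ := hy
    exact h.low le_rfl h1 (by omega) (by omega))
  simp at this
  nlinarith [Nat.zero_le (r1 * c1)]

/-- Incomparable nodes of the same component have far residues. -/
theorem key_inc (hℓ : 2 ≤ ℓ) (h2 : SS2F ℓ l n κ) {T : ℕ → Fin l × ℕ × ℕ} {m : ℕ}
    (h : Std T m) (hm : m ≤ n) {j : Fin l} {r1 c1 r2 c2 : ℕ}
    (m1 : Mem T m (j, r1, c1)) (m2 : Mem T m (j, r2, c2)) (hr : r1 < r2) (hc : c2 < c1) :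
    Far (res ℓ κ (j, r1, c1)) (res ℓ κ (j, r2, c2)) := by
  obtain ⟨k1, k2⟩ := card_inc h m1 m2 hr hc
  obtain ⟨s1, s2⟩ := h2 j
  obtain ⟨σ, hσ, hb⟩ := bar_shift hℓ (κ j)
  have hle := bar_le (ℓ := ℓ) (κ j)
  have b1 := hb ((c1 : ℤ) - r1)
  have b2 := hb ((c2 : ℤ) - r2)
  simp only [res]
  rw [add_sub_assoc, add_sub_assoc]
  unfold Far Bv at *
  rcases hσ with rfl | rfl
  · have b1 := b1 (by omega) (by omega)
    have b2 := b2 (by omega) (by omega)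
    omega
  · have b1 := b1 (by omega) (by omega)
    have b2 := b2 (by omega) (by omega)
    omega

theorem key_comp (hℓ : 2 ≤ ℓ) (h1 : SS1F ℓ l n κ) (h2 : SS2F ℓ l n κ)
    {T : ℕ → Fin l × ℕ × ℕ} {m : ℕ}
    (h : Std T m) (hm : m ≤ n) {j j' : Fin l} {r1 c1 r2 c2 : ℕ}
    (m1 : Mem T m (j, r1, c1)) (m2 : Mem T m (j', r2, c2)) (hj : j ≠ j') :
    Far (res ℓ κ (j, r1, c1)) (res ℓ κ (j', r2, c2)) := by
  have k := card_two h m1 m2 hj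
  have k' : r1 + c1 + 1 + (r2 + c2 + 1) ≤ m := by
    nlinarith [Nat.zero_le (r1 * c1), Nat.zero_le (r2 * c2)]
  obtain ⟨s1, s2⟩ := h2 j
  obtain ⟨s1', s2'⟩ := h2 j'
  have hle := bar_le (ℓ := ℓ) (κ j)
  have hle' := bar_le (ℓ := ℓ) (κ j')
  have hd : (barF ℓ (κ j)).val + n ≤ (barF ℓ (κ j')).val ∨
      (barF ℓ (κ j')).val + n ≤ (barF ℓ (κ j)).val := by
    by_contra hcon
    apply hj
    rcases le_total (barF ℓ (κ j)).val (barF ℓ (κ j')).val with hab | hab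
    · refine h1 (barF ℓ (κ j)).val hle j j' ⟨0, by omega, ?_⟩
        ⟨(barF ℓ (κ j')).val - (barF ℓ (κ j)).val, by omega, ?_⟩
      · rw [Nat.mod_eq_of_lt (by omega)]; omega
      · rw [Nat.mod_eq_of_lt (by omega)]; omega
    · refine h1 (barF ℓ (κ j')).val hle' j j'
        ⟨(barF ℓ (κ j)).val - (barF ℓ (κ j')).val, by omega, ?_⟩ ⟨0, by omega, ?_⟩
      · rw [Nat.mod_eq_of_lt (by omega)]; omega
      · rw [Nat.mod_eq_of_lt (by omega)]; omega
  obtain ⟨σ, hσ, hb⟩ := bar_shift hℓ (κ j)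
  obtain ⟨σ', hσ', hb'⟩ := bar_shift hℓ (κ j')
  have b1 := hb ((c1 : ℤ) - r1)
  have b2 := hb' ((c2 : ℤ) - r2)
  simp only [res]
  rw [add_sub_assoc, add_sub_assoc]
  have t1 : |((barF ℓ (κ j + ((c1 : ℤ) - r1))).val : ℤ) - (barF ℓ (κ j)).val| ≤ r1 + c1 := by
    rw [abs_le]
    unfold Bv at *
    rcases hσ with rfl | rfl
    · have b1 := b1 (by omega) (by omega); omega
    · have b1 := b1 (by omega) (by omega); omega
  have t2 : |((barF ℓ (κ j' + ((c2 : ℤ) - r2))).val : ℤ) - (barF ℓ (κ j')).val| ≤ r2 + c2 := by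
    rw [abs_le]
    unfold Bv at *
    rcases hσ' with rfl | rfl
    · have b1 := b2 (by omega) (by omega); omega
    · have b1 := b2 (by omega) (by omega); omega
  rw [abs_le] at t1 t2
  unfold Far
  omega

/-- Near residues force same component and comparability. -/
theorem key (hℓ : 2 ≤ ℓ) (h1 : SS1F ℓ l n κ) (h2 : SS2F ℓ l n κ)
    {T : ℕ → Fin l × ℕ × ℕ} {m : ℕ}
    (h : Std T m) (hm : m ≤ n) {j j' : Fin l} {r1 c1 r2 c2 : ℕ}
    (m1 : Mem T m (j, r1, c1)) (m2 : Mem T m (j', r2, c2))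
    (hnear : ¬ Far (res ℓ κ (j, r1, c1)) (res ℓ κ (j', r2, c2))) :
    j = j' ∧ ((r1 ≤ r2 ∧ c1 ≤ c2) ∨ (r2 ≤ r1 ∧ c2 ≤ c1)) := by
  by_cases hj : j = j'
  · subst hj
    refine ⟨rfl, ?_⟩
    by_contra hcon
    by_cases hr : r1 < r2
    · exact hnear (key_inc hℓ h2 h hm m1 m2 hr (by omega))
    · exact hnear (key_inc hℓ h2 h hm m2 m1 (by omega) (by omega)).symm
  · exact absurd (key_comp hℓ h1 h2 h hm m1 m2 hj) hnear

end Comb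

section Main
variable {F} {ℓ n l : ℕ} {κ : Fin l → ℤ}

theorem exists_last (P : ℕ → Prop) (q : ℕ) (h : ∃ s < q, P s) :
    ∃ s < q, P s ∧ ∀ u, s < u → u < q → ¬ P u := by
  induction q with
  | zero => obtain ⟨s, hs, _⟩ := h; omega
  | succ q ih =>
    by_cases hq : P q
    · exact ⟨q, by omega, hq, fun u h1 h2 => by omega⟩
    · obtain ⟨s, hs, hP⟩ := h
      have hsq : s ≠ q := by rintro rfl; exact hq hP
      obtain ⟨s', a, b, c⟩ := ih ⟨s, by omega, hP⟩
      refine ⟨s', by omega, b, fun u h1 h2 => ?_⟩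
      by_cases hu : u = q
      · rw [hu]; exact hq
      · exact c u h1 (by omega)

theorem res_eq {j : Fin l} {r c : ℕ} {z : ℤ} (h : κ j + (c : ℤ) - (r : ℤ) = z) :
    res ℓ κ (j, r, c) = barF ℓ z := by
  rw [← h]; rfl

theorem wt_le (hn : 0 < n) (h1 : SS1F ℓ l n κ) (k : Fin (ℓ + 1)) : wtMultF ℓ κ k ≤ 1 := by
  unfold wtMultF
  rw [Finset.card_le_one]
  intro a ha b hb
  simp only [Finset.mem_filter, Finset.mem_univ, true_and] at ha hb
  have := k.isLt
  refine h1 k.val (by omega) a b ⟨0, hn, ?_⟩ ⟨0, hn, ?_⟩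
  · rw [ha, Nat.mod_eq_of_lt (by omega)]; rfl
  · rw [hb, Nat.mod_eq_of_lt (by omega)]; rfl

/-- no entries between `t` and `s` have residues near that of `T t`, when the nodes right of and
below `T t` are not yet present. -/
theorem between (hℓ : 2 ≤ ℓ) (h1 : SS1F ℓ l n κ) (h2 : SS2F ℓ l n κ)
    {T : ℕ → Fin l × ℕ × ℕ} {s t : ℕ} (h : Std T s) (hs : s ≤ n) (hts : t < s)
    {j : Fin l} {r c : ℕ} (ht : T t = (j, r, c))
    (hA : ¬ Mem T s (j, r + 1, c)) (hB : ¬ Mem T s (j, r, c + 1)) :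
    ∀ u, t < u → u < s → Far (res ℓ κ (T t)) (res ℓ κ (T u)) := by
  intro u htu hus
  by_contra hcon
  rcases hTu : T u with ⟨j', r', c'⟩
  rw [ht, hTu] at hcon
  have mu : Mem T s (j', r', c') := ⟨u, hus, hTu⟩
  obtain ⟨rfl, hc⟩ := key hℓ h1 h2 h hs ⟨t, hts, ht⟩ mu hcon
  have hlow : ¬ (r' ≤ r ∧ c' ≤ c) := by
    rintro ⟨a, b⟩
    obtain ⟨k, hk, e⟩ := h.low (p := t + 1) (by omega) ⟨t, by omega, ht⟩ a b
    have := h.1 k (by omega) u hus (e.trans hTu.symm)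
    omega
  rcases hc with ⟨a, b⟩ | hc
  · by_cases hr : r = r'
    · exact hB (h.low le_rfl mu (by omega) (by omega))
    · exact hA (h.low le_rfl mu (by omega) (by omega))
  · exact hlow hc

theorem step (hℓ : 2 ≤ ℓ) (h1 : SS1F ℓ l n κ) (h2 : SS2F ℓ l n κ) (q : ℕ) (hq : q < n)
    (hx : ∀ r < q, xN F ℓ n l κ r = 0)
    (he : ∀ p < q, ∀ T : ℕ → Fin l × ℕ × ℕ, Std T p → ∀ i : ℕ → Fin (ℓ + 1),
      (∀ u < p, res ℓ κ (T u) = i u) →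
      (∀ j r c, Addable T p j r c → res ℓ κ (j, r, c) ≠ i p) → eN F ℓ n l κ i = 0)
    (T : ℕ → Fin l × ℕ × ℕ) (hT : Std T q) (i : ℕ → Fin (ℓ + 1))
    (hi : ∀ u < q, res ℓ κ (T u) = i u) :
    xN F ℓ n l κ q * eN F ℓ n l κ i = 0 ∧
      (eN F ℓ n l κ i = 0 ∨ ∃ j r c, Addable T q j r c ∧ res ℓ κ (j, r, c) = i q) := by
  by_cases hs : ∃ s < q, ¬ Far (i s) (i q)
  swap
  · -- the last strand commutes to the front
    push Not at hs
    obtain ⟨i', a1, a2, a3, a4⟩ := down (F := F) (n := n) (κ := κ) 0 q i (by omega)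
      (by intro u _ hu; rw [zero_add]; exact hs u (by omega))
    rw [zero_add] at a2 a4
    have hc := R_cyc (F := F) (κ := κ) (by omega : 0 < n) i'
    rw [a2] at hc
    by_cases hk : ∃ j, barF ℓ (κ j) = i q
    · obtain ⟨j, hj⟩ := hk
      have hw := wt_le (by omega : 0 < n) h1 (i q)
      refine ⟨a4 ?_, Or.inr ⟨j, 0, 0, addable_of hT ?_ (Or.inl rfl) (Or.inl rfl), ?_⟩⟩
      · rcases Nat.le_one_iff_eq_zero_or_eq_one.1 hw with hw | hw
        · rw [hw, pow_zero, one_mul] at hc; rw [hc, mul_zero]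
        · rwa [hw, pow_one] at hc
      · rintro ⟨k, hk, e⟩
        have := hs k hk
        rw [← hi k hk, e, res_eq (z := κ j) (by simp), hj] at this
        exact this.1 rfl
      · rw [res_eq (z := κ j) (by simp), hj]
    · have hw : wtMultF ℓ κ (i q) = 0 := by
        unfold wtMultF
        rw [Finset.card_eq_zero, Finset.filter_eq_empty_iff]
        intro j _ hj
        exact hk ⟨j, hj⟩
      rw [hw, pow_zero, one_mul] at hc
      have := a3 hc
      exact ⟨by rw [this, mul_zero], Or.inl this⟩
  obtain ⟨s, hsq, hnear, hlast⟩ := exists_last _ q hs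
  simp only [not_not] at hlast
  obtain ⟨i', a1, a2, a3, a4⟩ := down (F := F) (n := n) (κ := κ) (s + 1) (q - (s + 1)) i (by omega)
    (by
      have e : s + 1 + (q - (s + 1)) = q := by omega
      rw [e]; intro u hu1 hu2; exact hlast u (by omega) hu2)
  have e : s + 1 + (q - (s + 1)) = q := by omega
  rw [e] at a2 a4
  have ai : ∀ u ≤ s, i' u = i u := fun u hu => a1 u (by omega)
  by_cases hkk : i s = i q
  · have h0 := a3 (kk i' s (by omega) (by rw [ai s le_rfl, a2, hkk]) (hx s hsq))
    exact ⟨by rw [h0, mul_zero], Or.inl h0⟩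
  have hadj : (i q).val = (i s).val + 1 ∨ (i s).val = (i q).val + 1 := by
    unfold Far at hnear
    have : (i s).val ≠ (i q).val := fun h => hkk (Fin.ext h)
    omega
  rcases hTs : T s with ⟨j, r, c⟩
  have hres : res ℓ κ (j, r, c) = i s := by rw [← hTs]; exact hi s hsq
  have hT1 : Std T (s + 1) := hT.mono (by omega)
  have hTs0 : Std T s := hT.mono (by omega)
  have hms : Mem T (s + 1) (j, r, c) := ⟨s, by omega, hTs⟩
  have hnms : ¬ Mem T s (j, r, c) := by
    rintro ⟨k, hk, e⟩
    have := hT.1 k (by omega) s hsq (e.trans hTs.symm)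
    omega
  -- the swapped idempotent vanishes
  have hsw : eN F ℓ n l κ (swN s i') = 0 := by
    refine he s hsq T hTs0 _ (fun u hu => ?_) ?_
    · rw [swN_o _ _ _ (by omega) (by omega), ai u (by omega)]; exact hi u (by omega)
    · rw [swN_l, a2]
      intro j' r' c' hadd hr'
      have hne : (j', r', c') ≠ (j, r, c) := by
        intro h; rw [h, hres] at hr'; exact hkk hr'
      have hnm : ¬ Mem T (s + 1) (j', r', c') := by
        rintro ⟨k, hk, e⟩
        by_cases hks : k = s
        · rw [hks, hTs] at e; exact hne e.symm
        · exact hadd.1 ⟨k, by omega, e⟩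
      have hadd' : Addable T (s + 1) j' r' c' :=
        ⟨hnm, fun a b ha hb hab => (hadd.2 a b ha hb hab).mono (by omega)⟩
      have hext := hT1.extend hadd'
      obtain ⟨rfl, hcmp⟩ := key hℓ h1 h2 hext (by omega)
        (((mem_update le_rfl _ _).2 hms).mono (by omega))
        ⟨s + 1, by omega, Function.update_self _ _ _⟩
        (by rw [hres, hr']; exact hnear)
      rcases hcmp with ⟨h3, h4⟩ | ⟨h3, h4⟩
      · exact hnms (hadd.2 r c h3 h4 (by
          intro h
          simp only [Prod.mk.injEq] at h
          exact hne (by rw [h.1, h.2])))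
      · exact hnm (hT1.low le_rfl hms h3 h4)
  -- nodes above `T s` with residue `i q` are absent
  have hnew : ∀ r' c', r ≤ r' → c ≤ c' → res ℓ κ (j, r', c') = i q → ¬ Mem T q (j, r', c') := by
    rintro r' c' h3 h4 h5 ⟨k, hk, e⟩
    rcases lt_trichotomy k s with hks | hks | hks
    · exact hnms (hTs0.low le_rfl ⟨k, hks, e⟩ h3 h4)
    · rw [hks, hTs] at e; rw [← e, hres] at h5; exact hkk h5
    · have := hlast k hks hk
      rw [← hi k hk, e, h5] at this
      exact this.1 rfl
  -- moving an earlier entry of the same residue next to `s`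
  have hsand : ∀ t < s, i t = i q → (∀ u, t < u → u < s → Far (res ℓ κ (T t)) (res ℓ κ (T u))) →
      (((i s).val ≠ 0 ∧ (i s).val ≠ ℓ) → eN F ℓ n l κ i = 0) ∧
      (((i s).val = 0 ∨ (i s).val = ℓ) → xN F ℓ n l κ q * eN F ℓ n l κ i = 0) := by
    intro t hts hit hfar
    obtain ⟨i'', b1, b2, b3, b4⟩ := up (F := F) (n := n) (κ := κ) (s - 1 - t) t i' (by omega) (by
      intro u hu1 hu2
      have := hfar u hu1 (by omega)
      rw [hi t (by omega), hi u (by omega)] at this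
      rw [ai t (by omega), ai u (by omega)]; exact this)
    have et : t + (s - 1 - t) = s - 1 := by omega
    rw [et] at b1 b2 b4
    obtain ⟨s', rfl⟩ : ∃ s', s = s' + 1 := ⟨s - 1, by omega⟩
    simp only [Nat.add_sub_cancel] at b1 b2 b4
    have v0 : i'' s' = i q := by rw [b2, ai t (by omega), hit]
    have v1 : i'' (s' + 1) = i (s' + 1) := by rw [b1 _ (by omega), ai _ le_rfl]
    have v2 : i'' (s' + 2) = i q := by rw [b1 _ (by omega)]; exact a2
    have w1 := hx s' (by omega)
    have w2 := hx (s' + 1) (by omega)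
    have hlt := (i q).isLt
    constructor
    · intro hne
      exact a3 (b3 (sand_e i'' s' (by omega) (v0.trans v2.symm) w1 w2 (by rw [v0, v1]; omega)
        (by rw [v1]; exact hne.1) (by rw [v1]; exact hne.2)))
    · intro hne
      exact a4 (b4 _ (by omega) (sand_x i'' s' (by omega) (v0.trans v2.symm) w1 w2
        (by rw [v0, v1]; omega)))
  obtain ⟨z, hz⟩ : ∃ z : ℤ, κ j + (c : ℤ) - (r : ℤ) = z := ⟨_, rfl⟩
  have hbz : barF ℓ z = i s := by rw [← res_eq hz]; exact hres
  have hk := bar_adj hℓ z (i q) (by rw [hbz]; exact hadj)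
  by_cases hspec : (i s).val = 0 ∨ (i s).val = ℓ
  · obtain ⟨hb1, hb2, hb3⟩ := bar_end hℓ z (by rw [hbz]; exact hspec)
    have hz1 : barF ℓ (z + 1) = i q := by
      rcases hk with hk | hk
      · exact hk
      · rw [hb1]; exact hk
    have hz2 : barF ℓ (z - 1) = i q := by rw [← hb1]; exact hz1
    have hne0 : ¬ (r = 0 ∧ c = 0) := by
      rintro ⟨rfl, rfl⟩
      have hzz : z = κ j := by rw [← hz]; simp
      obtain ⟨s1, s2⟩ := h2 j
      rw [← hzz, hbz] at s1 s2
      omega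
    rcases Nat.eq_zero_or_pos c with rfl | hc
    · obtain ⟨r0, rfl⟩ : ∃ r0, r = r0 + 1 := ⟨r - 1, by omega⟩
      have rβ : res ℓ κ (j, r0 + 2, 0) = i q := by
        rw [res_eq (z := z - 1) (by rw [← hz]; push_cast; ring)]; exact hz2
      have rγ : res ℓ κ (j, r0, 0) = i q := by
        rw [res_eq (z := z + 1) (by rw [← hz]; push_cast; ring)]; exact hz1
      have hnβ := hnew (r0 + 2) 0 (by omega) le_rfl rβ
      have hadd : ∀ p, s + 1 ≤ p → p ≤ q → Addable T p j (r0 + 2) 0 := fun p hp1 hp2 =>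
        addable_of (hT.mono hp2) (fun h => hnβ (h.mono hp2))
          (Or.inr (hms.mono hp1)) (Or.inl rfl)
      refine ⟨?_, Or.inr ⟨j, r0 + 2, 0, hadd q (by omega) le_rfl, rβ⟩⟩
      have hη : ¬ Mem T s (j, r0, 1) := by
        intro hm
        have hext := hT1.extend (hadd (s + 1) le_rfl (by omega))
        have := (key hℓ h1 h2 hext (by omega)
          (((mem_update (by omega) _ _).2 hm).mono (by omega))
          ⟨s + 1, by omega, Function.update_self _ _ _⟩ (by
            rw [res_eq (z := z + 2) (by rw [← hz]; push_cast; ring), rβ, ← hz2]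
            exact hb2)).2
        omega
      obtain ⟨t, ht, hTt⟩ := hT1.low le_rfl hms (show r0 ≤ r0 + 1 by omega) (le_refl 0)
      have hts : t ≠ s := by rintro rfl; rw [hTs] at hTt; simp at hTt
      refine (hsand t (by omega) ?_ ?_).2 hspec
      · rw [← hi t (by omega), hTt, rγ]
      · exact between hℓ h1 h2 hTs0 (by omega) (by omega) hTt hnms hη
    · obtain ⟨c0, rfl⟩ : ∃ c0, c = c0 + 1 := ⟨c - 1, by omega⟩
      have hr : r = 0 := by
        by_contra hr
        obtain ⟨r0, rfl⟩ : ∃ r0, r = r0 + 1 := ⟨r - 1, by omega⟩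
        have := (key hℓ h1 h2 hT1 (by omega)
          (hT1.low le_rfl hms (show r0 ≤ r0 + 1 by omega) (le_refl (c0 + 1)))
          (hT1.low le_rfl hms (le_refl (r0 + 1)) (show c0 ≤ c0 + 1 by omega)) (by
            rw [res_eq (z := z + 1) (by rw [← hz]; push_cast; ring),
              res_eq (z := z - 1) (by rw [← hz]; push_cast; ring), hb1]
            exact fun h => h.1 rfl)).2
        omega
      subst hr
      have rβ : res ℓ κ (j, 0, c0 + 2) = i q := by
        rw [res_eq (z := z + 1) (by rw [← hz]; push_cast; ring)]; exact hz1
      have rγ : res ℓ κ (j, 0, c0) = i q := by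
        rw [res_eq (z := z - 1) (by rw [← hz]; push_cast; ring)]; exact hz2
      have hnβ := hnew 0 (c0 + 2) le_rfl (by omega) rβ
      have hadd : ∀ p, s + 1 ≤ p → p ≤ q → Addable T p j 0 (c0 + 2) := fun p hp1 hp2 =>
        addable_of (hT.mono hp2) (fun h => hnβ (h.mono hp2))
          (Or.inl rfl) (Or.inr (hms.mono hp1))
      refine ⟨?_, Or.inr ⟨j, 0, c0 + 2, hadd q (by omega) le_rfl, rβ⟩⟩
      have hη : ¬ Mem T s (j, 1, c0) := by
        intro hm
        have hext := hT1.extend (hadd (s + 1) le_rfl (by omega))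
        have := (key hℓ h1 h2 hext (by omega)
          (((mem_update (by omega) _ _).2 hm).mono (by omega))
          ⟨s + 1, by omega, Function.update_self _ _ _⟩ (by
            rw [res_eq (z := z - 2) (by rw [← hz]; push_cast; ring), rβ, ← hz1]
            exact hb3)).2
        omega
      obtain ⟨t, ht, hTt⟩ := hT1.low le_rfl hms (le_refl 0) (show c0 ≤ c0 + 1 by omega)
      have hts : t ≠ s := by rintro rfl; rw [hTs] at hTt; simp at hTt
      refine (hsand t (by omega) ?_ ?_).2 hspec
      · rw [← hi t (by omega), hTt, rγ]
      · exact between hℓ h1 h2 hTs0 (by omega) (by omega) hTt hη hnms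
  · have hspec' : (i s).val ≠ 0 ∧ (i s).val ≠ ℓ := by omega
    refine ⟨a4 (adj_x i' s (by omega) (by rw [a2, ai s le_rfl]; exact hadj)
      (by rw [ai s le_rfl]; exact hspec'.1) (by rw [ai s le_rfl]; exact hspec'.2)
      (hx s hsq) hsw), ?_⟩
    rcases hk with hk | hk
    · have rβ : res ℓ κ (j, r, c + 1) = i q := by
        rw [res_eq (z := z + 1) (by rw [← hz]; push_cast; ring)]; exact hk
      have hnβ := hnew r (c + 1) le_rfl (by omega) rβ
      by_cases hA : r = 0 ∨ Mem T s (j, r - 1, c + 1)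
      · exact Or.inr ⟨j, r, c + 1, addable_of hT hnβ (hA.imp id (fun h => h.mono (by omega)))
          (Or.inr (hms.mono (by omega))), rβ⟩
      · push Not at hA
        obtain ⟨r0, rfl⟩ : ∃ r0, r = r0 + 1 := ⟨r - 1, by omega⟩
        have rγ : res ℓ κ (j, r0, c) = i q := by
          rw [res_eq (z := z + 1) (by rw [← hz]; push_cast; ring)]; exact hk
        obtain ⟨t, ht, hTt⟩ := hT1.low le_rfl hms (show r0 ≤ r0 + 1 by omega) (le_refl c)
        have hts : t ≠ s := by rintro rfl; rw [hTs] at hTt; simp at hTt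
        refine Or.inl ((hsand t (by omega) ?_ ?_).1 hspec')
        · rw [← hi t (by omega), hTt, rγ]
        · exact between hℓ h1 h2 hTs0 (by omega) (by omega) hTt hnms hA.2
    · have rβ : res ℓ κ (j, r + 1, c) = i q := by
        rw [res_eq (z := z - 1) (by rw [← hz]; push_cast; ring)]; exact hk
      have hnβ := hnew (r + 1) c (by omega) le_rfl rβ
      by_cases hA : c = 0 ∨ Mem T s (j, r + 1, c - 1)
      · exact Or.inr ⟨j, r + 1, c, addable_of hT hnβ (Or.inr (hms.mono (by omega)))
          (hA.imp id (fun h => h.mono (by omega))), rβ⟩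
      · push Not at hA
        obtain ⟨c0, rfl⟩ : ∃ c0, c = c0 + 1 := ⟨c - 1, by omega⟩
        have rγ : res ℓ κ (j, r, c0) = i q := by
          rw [res_eq (z := z - 1) (by rw [← hz]; push_cast; ring)]; exact hk
        obtain ⟨t, ht, hTt⟩ := hT1.low le_rfl hms (le_refl r) (show c0 ≤ c0 + 1 by omega)
        have hts : t ≠ s := by rintro rfl; rw [hTs] at hTt; simp at hTt
        refine Or.inl ((hsand t (by omega) ?_ ?_).1 hspec')
        · rw [← hi t (by omega), hTt, rγ]
        · exact between hℓ h1 h2 hTs0 (by omega) (by omega) hTt hA.2 hnms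

/-- Either `e(i) = 0` or the first `q` residues come from a standard tableau. -/
theorem exists_tab (hl : Nonempty (Fin l)) (q : ℕ)
    (he : ∀ p < q, ∀ T : ℕ → Fin l × ℕ × ℕ, Std T p → ∀ i : ℕ → Fin (ℓ + 1),
      (∀ u < p, res ℓ κ (T u) = i u) →
      (∀ j r c, Addable T p j r c → res ℓ κ (j, r, c) ≠ i p) → eN F ℓ n l κ i = 0)
    (i : ℕ → Fin (ℓ + 1)) (hne : eN F ℓ n l κ i ≠ 0) (p : ℕ) (hp : p ≤ q) :
    ∃ T : ℕ → Fin l × ℕ × ℕ, Std T p ∧ ∀ u < p, res ℓ κ (T u) = i u := by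
  induction p with
  | zero =>
    obtain ⟨j⟩ := hl
    exact ⟨fun _ => (j, 0, 0), ⟨fun a ha => by omega, fun a ha => by omega⟩, fun u hu => by omega⟩
  | succ p ih =>
    obtain ⟨T, hT, hi⟩ := ih (by omega)
    by_contra hcon
    apply hne
    refine he p (by omega) T hT i hi ?_
    intro j r c hadd hr
    refine hcon ⟨_, hT.extend hadd, fun u hu => ?_⟩
    by_cases hup : u = p
    · rw [hup, Function.update_self, hr]
    · rw [Function.update_of_ne hup]; exact hi u (by omega)

theorem eN_sum {a : RC F ℓ n l κ} (h : ∀ i : ℕ → Fin (ℓ + 1), a * eN F ℓ n l κ i = 0) :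
    a = 0 := by
  rw [← mul_one a, ← R_sum, Finset.mul_sum]
  refine Finset.sum_eq_zero fun i _ => ?_
  have := h (fun k => if hk : k < n then i ⟨k, hk⟩ else 0)
  simpa [eN] using this

theorem main_ind (hl : Nonempty (Fin l)) (hℓ : 2 ≤ ℓ) (h1 : SS1F ℓ l n κ) (h2 : SS2F ℓ l n κ)
    (q : ℕ) (hq : q ≤ n) :
    (∀ r < q, xN F ℓ n l κ r = 0) ∧
    (∀ p < q, ∀ T : ℕ → Fin l × ℕ × ℕ, Std T p → ∀ i : ℕ → Fin (ℓ + 1),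
      (∀ u < p, res ℓ κ (T u) = i u) →
      (∀ j r c, Addable T p j r c → res ℓ κ (j, r, c) ≠ i p) → eN F ℓ n l κ i = 0) := by
  induction q with
  | zero => exact ⟨fun r hr => by omega, fun p hp => by omega⟩
  | succ q ih =>
    obtain ⟨hx, he⟩ := ih (by omega)
    constructor
    · intro r hr
      by_cases hrq : r = q
      · subst hrq
        refine eN_sum fun i => ?_
        by_cases h0 : eN F ℓ n l κ i = 0
        · rw [h0, mul_zero]
        · obtain ⟨T, hT, hi⟩ := exists_tab hl r he i h0 r le_rfl
          exact (step hℓ h1 h2 r (by omega) hx he T hT i hi).1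
      · exact hx r (by omega)
    · intro p hp T hT i hi hadd
      by_cases hpq : p = q
      · subst hpq
        rcases (step hℓ h1 h2 p (by omega) hx he T hT i hi).2 with h | ⟨j, r, c, h3, h4⟩
        · exact h
        · exact absurd h4 (hadd j r c h3)
      · exact he p (by omega) T hT i hi hadd

theorem e_zero_of_empty (hl : ¬ Nonempty (Fin l)) (hn : 0 < n) (i : ℕ → Fin (ℓ + 1)) :
    eN F ℓ n l κ i = 0 := by
  have := R_cyc (F := F) (κ := κ) hn i
  have hw : wtMultF ℓ κ (i 0) = 0 := by
    unfold wtMultF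
    rw [Finset.card_eq_zero, Finset.filter_eq_empty_iff]
    intro j _
    exact absurd ⟨j⟩ hl
  rwa [hw, pow_zero, one_mul] at this

/-- a standard sequence of nodes gives an element of `I^n_Λ`. -/
theorem mem_InLambda (T : ℕ → Fin l × ℕ × ℕ) (hT : Std T n) (i : Fin n → Fin (ℓ + 1))
    (hi : ∀ u : Fin n, res ℓ κ (T u.val) = i u) : i ∈ InLambda ℓ l n κ := by
  classical
  let S : Finset (Fin l × ℕ × ℕ) := (Finset.range n).image T
  have hS : ∀ y, y ∈ S ↔ Mem T n y := by
    intro y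
    simp only [S, Finset.mem_image, Finset.mem_range]
    exact Iff.rfl
  let lam : Fin l → YoungDiagram := fun j =>
    { cells := (S.filter (fun y => y.1 = j)).image Prod.snd
      isLowerSet := by
        rintro ⟨r, c⟩ ⟨r', c'⟩ hle hm
        simp only [Finset.coe_image, Finset.coe_filter, Set.mem_image, Set.mem_setOf_eq] at hm ⊢
        obtain ⟨⟨j', a, b⟩, ⟨hy, rfl⟩, hab⟩ := hm
        simp only [Prod.mk.injEq] at hab
        obtain ⟨rfl, rfl⟩ := hab
        refine ⟨(j', r', c'), ⟨(hS _).2 ?_, rfl⟩, rfl⟩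
        exact hT.low le_rfl ((hS _).1 hy) hle.1 hle.2 }
  have hlam : ∀ j p, p ∈ lam j ↔ (j, p) ∈ S := by
    intro j p
    rw [← YoungDiagram.mem_cells]
    simp only [lam, Finset.mem_image, Finset.mem_filter]
    constructor
    · rintro ⟨⟨j', p'⟩, ⟨hy, rfl⟩, rfl⟩; exact hy
    · intro h; exact ⟨(j, p), ⟨h, rfl⟩, rfl⟩
  refine ⟨lam, fun k => T k.val, ?_, ⟨?_, ?_, ?_⟩, ?_⟩
  · unfold IsMPT
    have h3 : S.card = n := by
      rw [Finset.card_image_of_injOn, Finset.card_range]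
      intro a ha b hb
      exact hT.1 a (by simpa using ha) b (by simpa using hb)
    rw [← h3, Finset.card_eq_sum_card_fiberwise (f := Prod.fst) (t := Finset.univ)
      (fun _ _ => Finset.mem_coe.2 (Finset.mem_univ _))]
    refine Finset.sum_congr rfl fun j _ => ?_
    refine Finset.card_image_of_injOn ?_
    rintro ⟨a, b⟩ ha ⟨a', b'⟩ hb h
    simp only [Finset.coe_filter, Set.mem_setOf_eq] at ha hb
    simp only at h
    rw [Prod.mk.injEq]
    exact ⟨ha.2.trans hb.2.symm, h⟩
  · intro a b h
    exact Fin.ext (hT.1 a a.isLt b b.isLt h)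
  · intro j p
    rw [hlam, hS]
    constructor
    · rintro ⟨k, hk, e⟩; exact ⟨⟨k, hk⟩, e⟩
    · rintro ⟨k, e⟩; exact ⟨k, k.isLt, e⟩
  · rintro m j ⟨r, c⟩ ⟨r', c'⟩ hle ⟨k, hk, e⟩
    obtain ⟨k', hk', e'⟩ := hT.low (p := k.val + 1) (by have := k.isLt; omega)
      ⟨k.val, by omega, e⟩ hle.1 hle.2
    exact ⟨⟨k', by have := k.isLt; omega⟩, by simp only; omega, e'⟩
  · funext k
    exact hi k

end Main
end QHP

/-- Lemma 3.8 (with Lemma 3.7): if (SS1) and (SS2) hold then `e(i) = 0` for `i ∉ I^n_Λ`,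
`x_r e(i) = 0` for all `i ∈ I^n_Λ` and all `r`, and hence `x_1 = … = x_n = 0` in `R^Λ_n`. -/
theorem x_eq_zero (ℓ n l : ℕ) (hℓ : 2 ≤ ℓ) (hn : 0 < n) (κ : Fin l → ℤ)
    (h1 : SS1F ℓ l n κ) (h2 : SS2F ℓ l n κ) :
    (∀ i : Fin n → Fin (ℓ + 1), i ∉ InLambda ℓ l n κ → QH.gE F ℓ n l κ i = 0) ∧
    (∀ i : Fin n → Fin (ℓ + 1), i ∈ InLambda ℓ l n κ →
      ∀ r : Fin n, QH.gX F ℓ n l κ r * QH.gE F ℓ n l κ i = 0) ∧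
    (∀ r : Fin n, QH.gX F ℓ n l κ r = 0) := by
  have key1 : ∀ i : Fin n → Fin (ℓ + 1), QH.gE F ℓ n l κ i =
      QHP.eN F ℓ n l κ (fun k => if hk : k < n then i ⟨k, hk⟩ else 0) := by
    intro i; simp [QHP.eN]
  have hX : ∀ r : Fin n, QH.gX F ℓ n l κ r = 0 := by
    intro r
    by_cases hl : Nonempty (Fin l)
    · have := (QHP.main_ind (F := F) hl hℓ h1 h2 n le_rfl).1 r.val r.isLt
      simpa [QHP.xN] using this
    · exact QHP.eN_sum fun i => by rw [QHP.e_zero_of_empty hl hn, mul_zero]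
  refine ⟨?_, ?_, hX⟩
  · intro i hi
    rw [key1]
    by_cases hl : Nonempty (Fin l)
    · by_contra hne
      obtain ⟨T, hT, hr⟩ := QHP.exists_tab hl n
        (QHP.main_ind (F := F) hl hℓ h1 h2 n le_rfl).2 _ hne n le_rfl
      refine hi (QHP.mem_InLambda T hT i fun u => ?_)
      have := hr u.val u.isLt
      simpa using this
    · exact QHP.e_zero_of_empty hl hn _
  · intro i _ r
    rw [hX, zero_mul]
end
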